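/- arXiv:1406.6299 — 4 statements merged into one kernel-verified Lean document; each statement's English description precedes it below -/
import Mathlib

section
/- Let $p$ be prime, $F$ an algebraically closed field of characteristic $p$, and $G = Z_{p^r}$ a cyclic group of order $p^r$ with generator $\sigma$. Let $V = \bigoplus_{j=1}^k V_{n_j}$ be a $G$-module, where $V_{n_j}$ is the indecomposable module of dimension $n_j \le p^r$ on which $\sigma^{-1}$ acts by a single Jordan block with eigenvalue $1$, with basis $e_{1,j},\dots,e_{n_j,j}$ and dual basis variables $x_{1,j},\dots,x_{n_j,j}$ in $F[V]$. For $0 \le s \le r$, let $J_s = \{ j : n_j > p^{s-1} \}$. If $M = \prod_{j=1}^k x_{n_j,j}^{a_j}$ is a monomial consisting only of the terminal variables $x_{n_j,j}$ that appears with nonzero coefficient in some invariant polynomial $f \in F[V]^G$, then $p^s$ divides $a_j$ for every $j \in J_s$. -/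
open MvPolynomial

/-- The action of the generator `σ` of the cyclic group on the polynomial ring of
`V = ⊕_j V_{n j}`: on the dual variables, `σ(x_{i,j}) = x_{i,j} + x_{i-1,j}` and
`σ(x_{1,j}) = x_{1,j}` (indices shifted to start at `0`). -/
noncomputable def sigmaAct {F : Type*} [Field F] {k : ℕ} (n : Fin k → ℕ) :
    MvPolynomial (Σ j : Fin k, Fin (n j)) F →ₐ[F] MvPolynomial (Σ j : Fin k, Fin (n j)) F :=
  aeval fun q => X q + if h : 0 < (q.2 : ℕ) then
    X ⟨q.1, ⟨(q.2 : ℕ) - 1, lt_of_le_of_lt (Nat.sub_le _ _) q.2.isLt⟩⟩ else 0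


lemma aeval_sigmaAct {F A : Type*} [Field F] [CommRing A] [Algebra F A] {k : ℕ} (n : Fin k → ℕ)
    (P : (Σ j : Fin k, Fin (n j)) → A) (f : MvPolynomial (Σ j : Fin k, Fin (n j)) F) :
    aeval P (sigmaAct n f) = aeval (fun q : (Σ j : Fin k, Fin (n j)) => P q +
      if h : 0 < (q.2 : ℕ) then
        P ⟨q.1, ⟨(q.2 : ℕ) - 1, lt_of_le_of_lt (Nat.sub_le _ _) q.2.isLt⟩⟩ else 0) f := by
  have : (aeval P).comp (sigmaAct (F := F) n) = aeval (fun q : (Σ j : Fin k, Fin (n j)) => P q +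
      if h : 0 < (q.2 : ℕ) then
        P ⟨q.1, ⟨(q.2 : ℕ) - 1, lt_of_le_of_lt (Nat.sub_le _ _) q.2.isLt⟩⟩ else 0) := by
    apply MvPolynomial.algHom_ext
    intro q
    simp only [sigmaAct, AlgHom.comp_apply, aeval_X, map_add]
    split_ifs <;> simp
  exact DFunLike.congr_fun this f

/-- the differential of an invariant at a fixed point kills the image of `σ⁻¹ - 1` -/
lemma pderiv_sigmaAct {F : Type*} [Field F] {k : ℕ} (n : Fin k → ℕ)
    (j : Fin k) (i : ℕ) (hi : i + 1 < n j) (f : MvPolynomial (Σ j : Fin k, Fin (n j)) F) :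
    pderiv ⟨j, ⟨i, by omega⟩⟩ (sigmaAct n f) =
      sigmaAct n (pderiv ⟨j, ⟨i, by omega⟩⟩ f) + sigmaAct n (pderiv ⟨j, ⟨i + 1, hi⟩⟩ f) := by
  classical
  induction f using MvPolynomial.induction_on with
  | C a => simp [sigmaAct]
  | add f g hf hg => simp only [map_add, hf, hg]; ring
  | mul_X f q hf =>
    have key : pderiv ⟨j, ⟨i, by omega⟩⟩ (sigmaAct (F := F) n (X q)) =
      sigmaAct n (pderiv ⟨j, ⟨i, by omega⟩⟩ (X q)) +
        sigmaAct n (pderiv ⟨j, ⟨i + 1, hi⟩⟩ (X q)) := by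
      obtain ⟨j', i', hi'⟩ := q
      simp only [sigmaAct, aeval_X, map_add, pderiv_X]
      congr 1
      · simp only [Pi.single_apply]
        split_ifs <;> simp
      · by_cases h : 0 < i'
        · simp only [h, dif_pos, pderiv_X, Pi.single_apply, Sigma.mk.injEq]
          by_cases hj : j' = j
          · subst hj
            by_cases h2 : i' = i + 1
            · subst h2; simp
            · have : ¬ (i' - 1 = i) := by omega
              simp [h2, this]
          · simp [hj]
        · have : i' ≠ i + 1 := by omega
          simp only [h, dif_neg, not_false_eq_true, map_zero, Pi.single_apply, Sigma.mk.injEq]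
          by_cases hj : j' = j
          · subst hj
            simp [this]
          · simp [hj]
    simp only [map_mul, Derivation.leibniz, smul_eq_mul, key, hf, map_add]
    ring

/-- cyclic invariants of degree `d` in `d` variables: first coordinate weighted sum. -/
lemma cyc_count {R : Type*} [CommRing R] (d : ℕ) [NeZero d] (G : MvPolynomial (ZMod d) R)
    (hG : ∀ c : ZMod d, rename (· + c) G = G) :
    ∑ m ∈ G.support with m.degree = d, G.coeff m * (m 0 : R) =
    ∑ m ∈ G.support with m.degree = d, G.coeff m := by
  classical
  have hco : ∀ (c : ZMod d) (m : ZMod d →₀ ℕ),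
      G.coeff (Finsupp.mapDomain (· + c) m) = G.coeff m := by
    intro c m
    conv_lhs => rw [← hG c]
    exact coeff_rename_mapDomain _ (add_left_injective c) G m
  set S := {m ∈ G.support | m.degree = d} with hS
  have hmain : ∀ κ : R, ∑ m ∈ S with G.coeff m = κ, m 0 = ({m ∈ S | G.coeff m = κ}).card := by
    intro κ
    have hsh : ∀ c : ZMod d, ∑ m ∈ S with G.coeff m = κ, m c = ∑ m ∈ S with G.coeff m = κ, m 0 := by
      intro c
      refine Finset.sum_bij' (fun m _ => Finsupp.mapDomain (· + (-c)) m)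
        (fun m _ => Finsupp.mapDomain (· + c) m) ?_ ?_ ?_ ?_ ?_
      · intro m hm
        simp only [hS, Finset.mem_filter, mem_support_iff, hco, Finsupp.degree_mapDomain] at hm ⊢
        exact hm
      · intro m hm
        simp only [hS, Finset.mem_filter, mem_support_iff, hco, Finsupp.degree_mapDomain] at hm ⊢
        exact hm
      · intro m hm
        rw [← Finsupp.mapDomain_comp]
        convert Finsupp.mapDomain_id using 2
        ext x; simp
      · intro m hm
        rw [← Finsupp.mapDomain_comp]
        convert Finsupp.mapDomain_id using 2
        ext x; simp
      · intro m hm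
        have := Finsupp.mapDomain_apply (add_left_injective (-c)) m c
        simpa using this.symm
    have h1 : d * ∑ m ∈ S with G.coeff m = κ, m 0 = d * ({m ∈ S | G.coeff m = κ}).card := by
      calc d * ∑ m ∈ S with G.coeff m = κ, m 0
          = ∑ c : ZMod d, ∑ m ∈ S with G.coeff m = κ, m c := by
            simp [hsh]
        _ = ∑ m ∈ S with G.coeff m = κ, ∑ c : ZMod d, m c := Finset.sum_comm
        _ = ∑ m ∈ S with G.coeff m = κ, d := by
            refine Finset.sum_congr rfl fun m hm => ?_
            simp only [hS, Finset.mem_filter] at hm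
            rw [← Finsupp.degree_eq_sum]; exact hm.1.2
        _ = _ := by simp [mul_comm]
    exact Nat.eq_of_mul_eq_mul_left (Nat.pos_of_ne_zero (NeZero.ne d)) h1
  rw [← Finset.sum_fiberwise_of_maps_to (t := S.image G.coeff) (g := G.coeff)
      (fun m hm => Finset.mem_image_of_mem _ hm),
    ← Finset.sum_fiberwise_of_maps_to (t := S.image G.coeff) (g := G.coeff)
      (fun m hm => Finset.mem_image_of_mem _ hm) (fun m => G.coeff m)]
  refine Finset.sum_congr rfl fun κ _ => ?_
  have e1 : ∀ m ∈ {m ∈ S | G.coeff m = κ}, G.coeff m * (m 0 : R) = κ * (m 0 : R) := by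
    intro m hm; rw [(Finset.mem_filter.1 hm).2]
  have e2 : ∀ m ∈ {m ∈ S | G.coeff m = κ}, G.coeff m = κ := by
    intro m hm; rw [(Finset.mem_filter.1 hm).2]
  rw [Finset.sum_congr rfl e1, Finset.sum_congr rfl e2, ← Finset.mul_sum, ← Nat.cast_sum, hmain]
  simp [mul_comm]

/-- the diagonal specialisation -/
lemma coeff_diag {R : Type*} [CommRing R] {ι : Type*} [Fintype ι] (G : MvPolynomial ι R) (d : ℕ) :
    (aeval (fun _ : ι => (Polynomial.X : Polynomial R)) G).coeff d =
      ∑ m ∈ G.support with m.degree = d, G.coeff m := by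
  classical
  conv_lhs => rw [G.as_sum]
  simp only [map_sum, aeval_monomial, Polynomial.finsetSum_coeff, Finset.sum_filter]
  refine Finset.sum_congr rfl fun m _ => ?_
  rw [Finsupp.prod_fintype _ _ (by simp), Finset.prod_pow_eq_pow_sum, ← Finsupp.degree_eq_sum,
    Polynomial.algebraMap_eq, Polynomial.coeff_C_mul, Polynomial.coeff_X_pow]
  simp [eq_comm]

lemma coeff_diag_pderiv {R : Type*} [CommRing R] {ι : Type*} [Fintype ι] (G : MvPolynomial ι R)
    (i : ι) (d : ℕ) (hd : 0 < d) :
    (aeval (fun _ : ι => (Polynomial.X : Polynomial R)) (pderiv i G)).coeff (d - 1) =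
      ∑ m ∈ G.support with m.degree = d, G.coeff m * (m i : R) := by
  classical
  conv_lhs => rw [G.as_sum]
  simp only [map_sum, pderiv_monomial, aeval_monomial, Polynomial.finsetSum_coeff,
    Finset.sum_filter]
  refine Finset.sum_congr rfl fun m _ => ?_
  rw [Finsupp.prod_fintype _ _ (by simp), Finset.prod_pow_eq_pow_sum, ← Finsupp.degree_eq_sum,
    Polynomial.algebraMap_eq, Polynomial.coeff_C_mul, Polynomial.coeff_X_pow]
  by_cases h0 : m i = 0
  · simp [h0]
  · have hle : Finsupp.single i 1 ≤ m := by
      simp; omega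
    have : (m - Finsupp.single i 1).degree + 1 = m.degree := by
      conv_rhs => rw [← tsub_add_cancel_of_le hle]
      simp
    have h2 : d - 1 = (m - Finsupp.single i 1).degree ↔ m.degree = d := by omega
    simp only [h2]
    split_ifs <;> simp

lemma not_dvd_choose_aux {p : ℕ} (hp : p.Prime) (t b : ℕ) (hb : ¬ p ∣ b) :
    ¬ p ∣ (p ^ t * b).choose (p ^ t) := by
  have := Fact.mk hp
  induction t with
  | zero => simpa using hb
  | succ t ih =>
    have h := Choose.choose_modEq_choose_mod_mul_choose_div_nat (p := p) (n := p ^ (t + 1) * b)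
      (k := p ^ (t + 1))
    have e1 : p ^ (t + 1) * b = p * (p ^ t * b) := by ring
    have e2 : p ^ (t + 1) = p * p ^ t := by ring
    rw [e1, e2, Nat.mul_mod_right, Nat.mul_mod_right, Nat.mul_div_cancel_left _ hp.pos,
      Nat.mul_div_cancel_left _ hp.pos, Nat.choose_self, one_mul] at h
    rw [e1, e2, h.dvd_iff dvd_rfl]
    exact ih

lemma taylor_coeff {F : Type*} [Field F] {k : ℕ} (j₀ : Fin k) (d : ℕ) (a : Fin k →₀ ℕ)
    (hd : d ≤ a j₀) (g : MvPolynomial (Fin k) F) :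
    ((aeval (fun j => (Polynomial.C (X j) + if j = j₀ then Polynomial.X else 0 :
      Polynomial (MvPolynomial (Fin k) F))) g).coeff d).coeff (a - Finsupp.single j₀ d) =
      ((a j₀).choose d : F) * g.coeff a := by
  classical
  induction g using MvPolynomial.induction_on' with
  | add f g hf hg => simp only [map_add, Polynomial.coeff_add, coeff_add, hf, hg]; ring
  | monomial b c =>
    have e : aeval (fun j => (Polynomial.C (X j) + if j = j₀ then Polynomial.X else 0 :
        Polynomial (MvPolynomial (Fin k) F))) (monomial b c) =
        Polynomial.C (monomial (b.erase j₀) c) * (Polynomial.X + Polynomial.C (X j₀)) ^ b j₀ := by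
      rw [aeval_monomial, Finsupp.prod_fintype _ _ (by simp),
        ← Finset.mul_prod_erase _ _ (Finset.mem_univ j₀), monomial_eq,
        Finsupp.prod_fintype _ _ (by simp), ← Finset.mul_prod_erase _ _ (Finset.mem_univ j₀)]
      have : ∏ x ∈ Finset.univ.erase j₀, (Polynomial.C (X x) + if x = j₀ then Polynomial.X else 0 :
          Polynomial (MvPolynomial (Fin k) F)) ^ b x =
          Polynomial.C (∏ x ∈ Finset.univ.erase j₀, X x ^ (b.erase j₀ x)) := by
        rw [map_prod]
        refine Finset.prod_congr rfl fun x hx => ?_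
        have := Finset.ne_of_mem_erase hx
        simp [this, Finsupp.erase_ne this]
      rw [this]
      have h2 : algebraMap F (Polynomial (MvPolynomial (Fin k) F)) c = Polynomial.C (C c) := rfl
      rw [h2]
      simp
      ring
    rw [e, Polynomial.coeff_C_mul, Polynomial.coeff_X_add_C_pow]
    have h3 : (((b j₀).choose d : ℕ) : MvPolynomial (Fin k) F) =
      C (((b j₀).choose d : ℕ) : F) := by simp
    rw [h3, X_pow_eq_monomial, ← mul_assoc, monomial_mul, mul_comm _ (C _), coeff_C_mul, coeff_monomial,
      coeff_monomial]
    by_cases hab : b = a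
    · subst hab
      have : b.erase j₀ + Finsupp.single j₀ (b j₀ - d) = b - Finsupp.single j₀ d := by
        ext x
        by_cases hx : x = j₀
        · subst hx; simp
        · simp [Finsupp.erase_ne hx, Finsupp.single_apply, Ne.symm hx]
      rw [if_pos this, if_pos rfl, mul_one]
    · rw [if_neg hab, mul_zero]
      by_cases hlt : b j₀ < d
      · simp [Nat.choose_eq_zero_of_lt hlt]
      · rw [if_neg, mul_zero]
        intro h
        apply hab
        ext x
        have hx' := DFunLike.congr_fun h x
        by_cases hx : x = j₀
        · subst hx; simp at hx'; omega
        · simpa [Finsupp.erase_ne hx, Finsupp.single_apply, Ne.symm hx] using hx'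

/-- the generic point of the regular representation through a fixed point -/
noncomputable def genPt (F : Type*) [Field F] {k : ℕ} (n : Fin k → ℕ) (j₀ : Fin k) (d : ℕ)
    [NeZero d] (q : Σ j : Fin k, Fin (n j)) : MvPolynomial (ZMod d) (MvPolynomial (Fin k) F) :=
  (if (q.2 : ℕ) + 1 = n q.1 then C (X q.1) else 0) +
    if q.1 = j₀ ∧ n q.1 - d ≤ (q.2 : ℕ) then
      ∑ c : ZMod d, (((c.val.choose ((q.2 : ℕ) - (n q.1 - d)) : ℕ)) :
        MvPolynomial (ZMod d) (MvPolynomial (Fin k) F)) * X c else 0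

lemma choose_val_add_one {A : Type*} [CommRing A] {p : ℕ} (hp : p.Prime) [CharP A p] (t : ℕ)
    [NeZero (p ^ t)] (c : ZMod (p ^ t)) (l : ℕ) (hl : l < p ^ t) :
    (((c + 1).val.choose l : ℕ) : A) = ((c.val + 1).choose l : ℕ) := by
  have hc := c.val_lt
  have e : (c + 1).val = (c.val + 1) % p ^ t := by
    rw [ZMod.val_add, ZMod.val_one_eq_one_mod, Nat.add_mod_mod]
  rw [e]
  by_cases h : c.val + 1 = p ^ t
  · rw [h, Nat.mod_self]
    rcases Nat.eq_zero_or_pos l with rfl | hl0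
    · simp
    · have h1 : ((p ^ t).choose l : A) = 0 := by
        rw [CharP.cast_eq_zero_iff A p]
        exact hp.dvd_choose_pow (by omega) (by omega)
      rw [h1, Nat.choose_eq_zero_of_lt hl0]; simp
  · rw [Nat.mod_eq_of_lt (by omega)]

lemma genPt_shift {F : Type*} [Field F] {p : ℕ} (hp : p.Prime) [CharP F p] {k : ℕ} (n : Fin k → ℕ)
    (j₀ : Fin k) (t : ℕ) [NeZero (p ^ t)] (hd : p ^ t ≤ n j₀) (q : Σ j : Fin k, Fin (n j)) :
    rename (· + (-1)) (genPt F n j₀ (p ^ t) q) = genPt F n j₀ (p ^ t) q +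
      if h : 0 < (q.2 : ℕ) then
        genPt F n j₀ (p ^ t) ⟨q.1, ⟨(q.2 : ℕ) - 1, lt_of_le_of_lt (Nat.sub_le _ _) q.2.isLt⟩⟩
      else 0 := by
  obtain ⟨j, i, hi⟩ := q
  have hterm : ∀ h : 0 < i, ¬ (i - 1 + 1 = n j) := by omega
  simp only [genPt, map_add]
  by_cases hj : j = j₀
  swap
  · simp only [hj, false_and, if_false, map_zero, add_zero]
    split_ifs <;> first | omega | simp
  subst hj
  have hpos : 0 < p ^ t := Nat.pos_of_ne_zero (NeZero.ne _)
  simp only [true_and]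
  set m := n j - p ^ t with hm
  have hre : ∀ l : ℕ, l < p ^ t → rename (· + (-1)) (∑ c : ZMod (p ^ t), (((c.val.choose l : ℕ)) :
        MvPolynomial (ZMod (p ^ t)) (MvPolynomial (Fin k) F)) * X c) =
      ∑ c : ZMod (p ^ t), ((((c.val + 1).choose l : ℕ)) :
        MvPolynomial (ZMod (p ^ t)) (MvPolynomial (Fin k) F)) * X c := by
    intro l hl
    rw [map_sum, ← Equiv.sum_comp (Equiv.addRight (1 : ZMod (p ^ t)))]
    refine Finset.sum_congr rfl fun c _ => ?_
    simp only [Equiv.coe_addRight, map_mul, map_natCast, rename_X, add_neg_cancel_right]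
    rw [choose_val_add_one hp t c l hl]
  have hA : rename (· + (-1)) (if i + 1 = n j then C (X j) else 0 :
      MvPolynomial (ZMod (p ^ t)) (MvPolynomial (Fin k) F)) =
      if i + 1 = n j then C (X j) else 0 := by
    split_ifs <;> simp
  rw [hA, add_assoc]
  congr 1
  by_cases h1 : m ≤ i
  · rw [if_pos h1, hre _ (by omega)]
    by_cases h2 : m + 1 ≤ i
    · rw [dif_pos (by omega), if_neg (hterm (by omega)), if_pos (by omega), zero_add,
        ← Finset.sum_add_distrib]
      refine Finset.sum_congr rfl fun c _ => ?_
      obtain ⟨l, hl⟩ : ∃ l, i = m + 1 + l := ⟨i - (m + 1), by omega⟩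
      have e1 : i - m = l + 1 := by omega
      have e2 : i - 1 - m = l := by omega
      rw [e1, e2, Nat.choose_succ_succ']
      push_cast; ring
    · have e1 : i - m = 0 := by omega
      rw [e1]
      have : (if h : 0 < i then (if i - 1 + 1 = n j then C (X j) else 0 :
          MvPolynomial (ZMod (p ^ t)) (MvPolynomial (Fin k) F)) +
          (if m ≤ i - 1 then ∑ c : ZMod (p ^ t), (((c.val.choose (i - 1 - m) : ℕ)) :
            MvPolynomial (ZMod (p ^ t)) (MvPolynomial (Fin k) F)) * X c else 0) else 0) = 0 := by
        split_ifs <;> first | omega | simp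
      rw [this]; simp
  · rw [if_neg h1]
    split_ifs <;> first | omega | simp

lemma genPt_diag {F : Type*} [Field F] {p : ℕ} (hp : p.Prime) [CharP F p] {k : ℕ} (n : Fin k → ℕ)
    (j₀ : Fin k) (t : ℕ) [NeZero (p ^ t)] (hd : p ^ t ≤ n j₀) (q : Σ j : Fin k, Fin (n j)) :
    aeval (fun _ => (Polynomial.X : Polynomial (MvPolynomial (Fin k) F)))
      (genPt F n j₀ (p ^ t) q) =
    if (q.2 : ℕ) + 1 = n q.1 then
      Polynomial.C (X q.1) + (if q.1 = j₀ then Polynomial.X else 0) else 0 := by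
  obtain ⟨j, i, hi⟩ := q
  simp only [genPt, map_add]
  have hA : aeval (fun _ : ZMod (p ^ t) => (Polynomial.X : Polynomial (MvPolynomial (Fin k) F)))
      (if i + 1 = n j then C (X j) else 0 :
      MvPolynomial (ZMod (p ^ t)) (MvPolynomial (Fin k) F)) =
      if i + 1 = n j then Polynomial.C (X j) else 0 := by
    split_ifs <;> simp
  rw [hA]
  have hpos : 0 < p ^ t := Nat.pos_of_ne_zero (NeZero.ne _)
  by_cases hj : j = j₀
  swap
  · simp [hj]
  subst hj
  simp only [true_and, if_true]
  have hsum : ∀ l : ℕ, l < p ^ t →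
      aeval (fun _ : ZMod (p ^ t) => (Polynomial.X : Polynomial (MvPolynomial (Fin k) F)))
      (∑ c : ZMod (p ^ t), (((c.val.choose l : ℕ)) :
        MvPolynomial (ZMod (p ^ t)) (MvPolynomial (Fin k) F)) * X c) =
      if l + 1 = p ^ t then Polynomial.X else 0 := by
    intro l hl
    simp only [map_sum, map_mul, map_natCast, aeval_X]
    rw [← Finset.sum_mul, ← Nat.cast_sum]
    have : ∑ c : ZMod (p ^ t), c.val.choose l = (p ^ t).choose (l + 1) := by
      have h0 : ∀ N : ℕ, ∑ c ∈ Finset.range N, c.choose l = N.choose (l + 1) := by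
        intro N
        induction N with
        | zero => simp
        | succ N ih => rw [Finset.sum_range_succ, ih, Nat.choose_succ_succ', add_comm]
      have h1 : ∑ c : ZMod (p ^ t), c.val.choose l = ∑ c ∈ Finset.range (p ^ t), c.choose l := by
        refine Finset.sum_bij' (fun c _ => c.val) (fun c _ => (c : ZMod (p ^ t))) ?_ ?_ ?_ ?_ ?_
        · intro c _; simpa using c.val_lt
        · simp
        · simp
        · intro c hc; exact ZMod.val_cast_of_lt (by simpa using hc)
        · simp
      rw [h1, h0]
    rw [this]
    split_ifs with h
    · rw [h]; simp
    · have h1 : (((p ^ t).choose (l + 1) : ℕ) : Polynomial (MvPolynomial (Fin k) F)) = 0 := by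
        rw [CharP.cast_eq_zero_iff _ p]
        exact hp.dvd_choose_pow (by omega) h
      rw [h1, zero_mul]
  by_cases h1 : n j - p ^ t ≤ i
  · rw [if_pos h1, hsum _ (by omega)]
    have : i - (n j - p ^ t) + 1 = p ^ t ↔ i + 1 = n j := by omega
    simp only [this]
    split_ifs <;> simp
  · rw [if_neg h1, map_zero, if_neg (by omega), if_neg (by omega), add_zero]

lemma genPt_pderiv {F : Type*} [Field F] {k : ℕ} (n : Fin k → ℕ)
    (j₀ : Fin k) (d : ℕ) [NeZero d] (hd : d ≤ n j₀) (hlt : n j₀ - d < n j₀)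
    (f : MvPolynomial (Σ j : Fin k, Fin (n j)) F) :
    pderiv 0 (aeval (genPt F n j₀ d) f) =
      aeval (genPt F n j₀ d) (pderiv ⟨j₀, ⟨n j₀ - d, hlt⟩⟩ f) := by
  classical
  induction f using MvPolynomial.induction_on with
  | C a =>
    have : aeval (genPt F n j₀ d) (C a : MvPolynomial (Σ j : Fin k, Fin (n j)) F) = C (C a) := by
      rw [aeval_C]; rfl
    rw [this]; simp
  | add f g hf hg => simp only [map_add, hf, hg]
  | mul_X f q hf =>
    have key : pderiv 0 (genPt F n j₀ d q) =
        aeval (genPt F n j₀ d) (pderiv ⟨j₀, ⟨n j₀ - d, hlt⟩⟩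
          (X q : MvPolynomial (Σ j : Fin k, Fin (n j)) F)) := by
      obtain ⟨j, i, hi⟩ := q
      simp only [genPt, map_add, pderiv_X, Pi.single_apply, Sigma.mk.injEq]
      have hA : pderiv (0 : ZMod d) (if i + 1 = n j then C (X j) else 0 :
          MvPolynomial (ZMod d) (MvPolynomial (Fin k) F)) = 0 := by
        split_ifs <;> simp
      rw [hA, zero_add]
      by_cases hj : j = j₀
      swap
      · simp [hj]
      subst hj
      have hder : ∀ l : ℕ, pderiv (0 : ZMod d) (∑ c : ZMod d, (((c.val.choose l : ℕ)) :
          MvPolynomial (ZMod d) (MvPolynomial (Fin k) F)) * X c) = if l = 0 then 1 else 0 := by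
        intro l
        simp only [map_sum, Derivation.leibniz, pderiv_X, Derivation.map_natCast, smul_zero,
          add_zero, Pi.single_apply, smul_eq_mul, mul_ite, mul_one, mul_zero]
        rcases l with _ | l <;> simp
      by_cases h1 : n j - d ≤ i
      · simp only [h1, and_self, if_true, hder]
        have : i - (n j - d) = 0 ↔ i = n j - d := by omega
        simp only [this]
        split_ifs <;> simp_all
      · have : i ≠ n j - d := by omega
        simp [h1, this]
    simp only [map_mul, Derivation.leibniz, smul_eq_mul, key, hf, map_add, aeval_X]

theorem stmt2 {F : Type*} [Field F] [IsAlgClosed F] {p : ℕ} (hp : p.Prime) [CharP F p]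
    (r k : ℕ) (n : Fin k → ℕ) (hn : ∀ j, 0 < n j) (hnr : ∀ j, n j ≤ p ^ r)
    (a : Fin k → ℕ) (f : MvPolynomial (Σ j : Fin k, Fin (n j)) F)
    (hf : sigmaAct n f = f)
    (hM : f.coeff (Finset.univ.sum fun j =>
      Finsupp.single ⟨j, ⟨n j - 1, Nat.sub_lt (hn j) one_pos⟩⟩ (a j)) ≠ 0)
    (s : ℕ) (hs : s ≤ r) :
    ∀ j, p ^ (s - 1) < n j → p ^ s ∣ a j := by
  classical
  intro j₀ hj₀
  by_contra hnd
  have ha0 : a j₀ ≠ 0 := by rintro h; simp [h] at hnd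
  obtain ⟨t, b, hb, hab⟩ := Nat.exists_eq_pow_mul_and_not_dvd ha0 p hp.ne_one
  have hts : t < s := by
    by_contra h
    exact hnd (hab ▸ Dvd.dvd.mul_right (pow_dvd_pow p (not_lt.1 h)) b)
  have hpos : 0 < p ^ t := pow_pos hp.pos t
  have hdn : p ^ t < n j₀ := lt_of_le_of_lt (Nat.pow_le_pow_right hp.pos (by omega)) hj₀
  have hNZ : NeZero (p ^ t) := ⟨hpos.ne'⟩
  have hlt : n j₀ - p ^ t < n j₀ := by omega
  set Y := genPt F n j₀ (p ^ t) with hY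
  set G := aeval Y f with hG
  -- cyclic invariance
  have hG1 : rename (· + (-1)) G = G := by
    have e1 : rename (· + (-1)) G = aeval (fun q => rename (· + (-1)) (Y q)) f := by
      have : ((rename (R := MvPolynomial (Fin k) F) (· + (-1 : ZMod (p ^ t)))).restrictScalars
          F).comp (aeval Y) = aeval (fun q => rename (· + (-1)) (Y q)) := by
        apply MvPolynomial.algHom_ext
        intro q
        simp
      exact DFunLike.congr_fun this f
    rw [e1]
    conv_rhs => rw [hG, ← hf, aeval_sigmaAct]
    congr 2
    funext q
    exact genPt_shift hp n j₀ t hdn.le q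
  have hGN : ∀ N : ℕ, rename (· + (N : ZMod (p ^ t)) * (-1)) G = G := by
    intro N
    induction N with
    | zero =>
      have : (· + ((0 : ℕ) : ZMod (p ^ t)) * (-1)) = (id : ZMod (p ^ t) → ZMod (p ^ t)) := by
        funext x; simp
      rw [this, rename_id]; rfl
    | succ N ih =>
      conv_rhs => rw [← hG1, ← ih, rename_rename]
      congr 2
      funext x
      simp; ring
  have hGc : ∀ c : ZMod (p ^ t), rename (· + c) G = G := by
    intro c
    have := hGN (-c).val
    simpa using this
  have hcount := cyc_count (p ^ t) G hGc
  rw [← coeff_diag, ← coeff_diag_pderiv G 0 (p ^ t) hpos, genPt_pderiv n j₀ _ hdn.le hlt] at hcount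
  -- diagonal point
  set Q : (Σ j : Fin k, Fin (n j)) → Polynomial (MvPolynomial (Fin k) F) := fun q =>
    if (q.2 : ℕ) + 1 = n q.1 then
      Polynomial.C (X q.1) + (if q.1 = j₀ then Polynomial.X else 0) else 0 with hQ
  have hdiag : ∀ g : MvPolynomial (Σ j : Fin k, Fin (n j)) F,
      aeval (fun _ => (Polynomial.X : Polynomial (MvPolynomial (Fin k) F))) (aeval Y g) =
        aeval Q g := by
    intro g
    have : ((aeval (R := MvPolynomial (Fin k) F) (fun _ : ZMod (p ^ t) =>
        (Polynomial.X : Polynomial (MvPolynomial (Fin k) F)))).restrictScalars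
          F).comp (aeval Y) = aeval Q := by
      apply MvPolynomial.algHom_ext
      intro q
      simpa using genPt_diag hp n j₀ t hdn.le q
    exact DFunLike.congr_fun this g
  have hfix : ∀ g : MvPolynomial (Σ j : Fin k, Fin (n j)) F, aeval Q (sigmaAct n g) = aeval Q g := by
    intro g
    rw [aeval_sigmaAct]
    congr 2
    funext q
    have := q.2.isLt
    have h2 : (if h : 0 < (q.2 : ℕ) then
        Q ⟨q.1, ⟨(q.2 : ℕ) - 1, lt_of_le_of_lt (Nat.sub_le _ _) q.2.isLt⟩⟩ else 0) = 0 := by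
      split_ifs with h
      · simp only [hQ]
        rw [if_neg]
        omega
      · rfl
    rw [h2, add_zero]
  have hzero : aeval Q (pderiv ⟨j₀, ⟨n j₀ - p ^ t, hlt⟩⟩ f) = 0 := by
    have h1 := pderiv_sigmaAct n j₀ (n j₀ - p ^ t - 1) (by omega) f
    have h2 := congrArg (aeval Q) h1
    rw [hf, map_add, hfix, hfix] at h2
    have h3 := left_eq_add.1 h2
    convert h3 using 6
    omega
  rw [hdiag, hdiag, hzero, Polynomial.coeff_zero] at hcount
  -- extraction of the coefficient
  let τ : Fin k → Σ j : Fin k, Fin (n j) := fun j => ⟨j, ⟨n j - 1, Nat.sub_lt (hn j) one_pos⟩⟩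
  have hτ : Function.Injective τ := fun x y h => congrArg Sigma.fst h
  have hkill : aeval Q f = aeval (fun j => (Polynomial.C (X j) + if j = j₀ then Polynomial.X else 0 :
      Polynomial (MvPolynomial (Fin k) F))) (killCompl hτ f) := by
    have : aeval Q = (aeval (fun j => (Polynomial.C (X j) + if j = j₀ then Polynomial.X else 0 :
      Polynomial (MvPolynomial (Fin k) F)))).comp (killCompl (R := F) hτ) := by
      apply MvPolynomial.algHom_ext
      rintro ⟨j, i, hi⟩
      by_cases h : i + 1 = n j
      · have e : (⟨j, ⟨i, hi⟩⟩ : Σ j : Fin k, Fin (n j)) = τ j := by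
          have : i = n j - 1 := by omega
          subst this; rfl
        rw [AlgHom.comp_apply, e]
        have := killCompl_rename_app (R := F) hτ (X j)
        rw [rename_X] at this
        rw [this, aeval_X, aeval_X]
        simp only [hQ, τ]
        rw [if_pos]
        have := hn j
        omega
      · rw [AlgHom.comp_apply, aeval_X]
        simp only [hQ, h, if_false]
        rw [killCompl, aeval_X, dif_neg, map_zero]
        rintro ⟨j', hj'⟩
        simp only [τ] at hj'
        obtain rfl : j' = j := congrArg Sigma.fst hj'
        have := hn j'
        simp at hj'
        omega
    rw [this]; rfl
  let a' : Fin k →₀ ℕ := Finsupp.equivFunOnFinite.symm a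
  have hle : p ^ t ≤ a' j₀ := by
    change p ^ t ≤ a j₀
    rw [hab]
    have : b ≠ 0 := by rintro rfl; simp at hb
    exact Nat.le_mul_of_pos_right _ (Nat.pos_of_ne_zero this)
  have hfin := taylor_coeff j₀ (p ^ t) a' hle (killCompl hτ f)
  rw [← hkill, ← hcount, coeff_zero, coeff_killCompl] at hfin
  have hm : Finsupp.mapDomain τ a' = Finset.univ.sum fun j =>
      Finsupp.single ⟨j, ⟨n j - 1, Nat.sub_lt (hn j) one_pos⟩⟩ (a j) := by
    rw [Finsupp.mapDomain, Finsupp.sum_fintype _ _ (by simp)]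
    rfl
  rw [hm] at hfin
  rcases mul_eq_zero.1 hfin.symm with h | h
  · rw [CharP.cast_eq_zero_iff F p] at h
    change p ∣ (a j₀).choose (p ^ t) at h
    rw [hab] at h
    exact not_dvd_choose_aux hp t b hb h
  · exact hM h
end

section
/- Let $F$ be an algebraically closed field of characteristic $p > 0$, $m$ coprime to $p$, and $\tilde G = Z_{p^r m}$ a cyclic group. Let $W_{n,\lambda}$ be the indecomposable $\tilde G$-module of dimension $n$ with $p^{r-1} < n \le p^r$, where a generator of the subgroup of order $p^r$ acts by a unipotent Jordan block and a generator of the subgroup of order $m$ acts by multiplication with a primitive $m$-th root of unity $\lambda \in F$ (so $W_{n,\lambda}$ is faithful). Then $\gamma(\tilde G, W_{n,\lambda}) = p^r m = |\tilde G|$. -/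
section


open MvPolynomial

/-- Action of the generator `σ` of the `p`-part: a unipotent Jordan block on the variables. -/
noncomputable def jordanAct {F : Type*} [Field F] (n : ℕ) :
    MvPolynomial (Fin n) F →ₐ[F] MvPolynomial (Fin n) F :=
  aeval fun i => X i + if _ : 0 < (i : ℕ) then
    X ⟨(i : ℕ) - 1, lt_of_le_of_lt (Nat.sub_le _ _) i.isLt⟩ else 0

/-- Action of the generator `α` of the `m`-part: scalar multiplication by `λ`. -/
noncomputable def scalAct {F : Type*} [Field F] (n : ℕ) (lam : F) :
    MvPolynomial (Fin n) F →ₐ[F] MvPolynomial (Fin n) F :=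
  aeval fun i => C lam * X i

/-- `ε(G̃,v)` for `G̃ = Z_{p^r m}` acting on `W_{n,λ}`. -/
noncomputable def epsW {F : Type*} [Field F] (n : ℕ) (lam : F) (v : Fin n → F) : ℕ :=
  sInf {d : ℕ | 0 < d ∧ ∃ f : MvPolynomial (Fin n) F,
    jordanAct n f = f ∧ scalAct n lam f = f ∧ f.IsHomogeneous d ∧ eval v f ≠ 0}

/-- `γ(G̃, W_{n,λ})`: supremum of `ε(G̃,v)` over all nonzero `v`. -/
noncomputable def gammaW {F : Type*} [Field F] (n : ℕ) (lam : F) : ℕ :=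
  sSup {e : ℕ | ∃ v : Fin n → F, v ≠ 0 ∧ e = epsW n lam v}


end


open Polynomial in
/-- A polynomial invariant under translation by `T` is a polynomial in `X^p - T^(p-1) X`. -/
lemma exists_comp_of_translate {R : Type*} [CommRing R] [IsDomain R] {p : ℕ} (hp : p.Prime)
    [CharP R p] (T : R) (hT : T ≠ 0) :
    ∀ (N : ℕ) (f : R[X]), f.natDegree < N → f.comp (X + C T) = f →
      ∃ g : R[X], f = g.comp (X ^ p - C (T ^ (p - 1)) * X) := by
  have : Fact p.Prime := ⟨hp⟩
  set L : R[X] := X ^ p - C (T ^ (p - 1)) * X with hL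
  have hdeg : (C (T ^ (p - 1)) * X : R[X]).degree < (p : ℕ) := by
    refine lt_of_le_of_lt (degree_C_mul_X_le _) ?_
    exact_mod_cast hp.one_lt
  have hLm : L.Monic := monic_X_pow_sub hdeg
  have hLd : L.natDegree = p := by
    rw [hL]; apply natDegree_eq_of_degree_eq_some
    rw [degree_sub_eq_left_of_degree_lt] <;> rw [degree_X_pow]
    exact hdeg
  have hTp : T ^ (p - 1) * T = T ^ p := by
    rw [← pow_succ, Nat.sub_add_cancel hp.one_le]
  have hLT : L.comp (X + C T) = L := by
    simp only [hL, sub_comp, pow_comp, X_comp, mul_comp, C_comp]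
    rw [add_pow_char, mul_add, ← C_pow, ← C_mul, hTp]
    ring
  intro N
  induction N with
  | zero => intro f hf; omega
  | succ N ih =>
    intro f hf hinv
    have h1 := modByMonic_add_div f L
    have h2 : (f %ₘ L).comp (X + C T) + L * (f /ₘ L).comp (X + C T) = f := by
      conv_rhs => rw [← hinv, ← h1]
      rw [add_comp, mul_comp, hLT]
    have hlt : (f %ₘ L).degree < L.degree := degree_modByMonic_lt _ hLm
    have hlt2 : ((f %ₘ L).comp (X + C T)).degree < L.degree := by
      have : (f %ₘ L).comp (X + C T) = taylor T (f %ₘ L) := by rw [taylor_apply]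
      rw [this, degree_taylor]; exact hlt
    obtain ⟨hq, hr⟩ := div_modByMonic_unique _ _ hLm ⟨h2, hlt2⟩
    -- remainder is constant
    have hconst : f %ₘ L = C ((f %ₘ L).eval 0) := by
      rw [← sub_eq_zero]
      set rr := f %ₘ L with hrr
      have hev : ∀ k : ℕ, rr.eval ((k : R) * T) = rr.eval 0 := by
        intro k
        induction k with
        | zero => simp
        | succ k ihk =>
          rw [← ihk]
          conv_rhs => rw [hr]
          rw [eval_comp]
          congr 1
          simp; ring
      by_contra hne
      have hdd : (rr - C (rr.eval 0)).degree < (p : ℕ) := by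
        have : L.degree = (p : ℕ) := by rw [degree_eq_natDegree hLm.ne_zero, hLd]
        rw [this] at hlt
        refine lt_of_le_of_lt (degree_sub_le _ _) (max_lt hlt ?_)
        refine lt_of_le_of_lt degree_C_le ?_
        exact_mod_cast hp.pos
      apply hne
      classical
      let S : Finset R := (Finset.range p).image (fun k : ℕ => (k : R) * T)
      have hS : S.card = p := by
        rw [Finset.card_image_of_injOn, Finset.card_range]
        intro a ha b hb hab
        have := mul_right_cancel₀ hT hab
        simp only [Finset.coe_range, Set.mem_Iio] at ha hb
        exact CharP.natCast_injOn_Iio R p ha hb this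
      apply eq_zero_of_degree_lt_of_eval_finset_eq_zero S
      · rw [hS]; exact hdd
      · intro x hx
        obtain ⟨k, -, rfl⟩ := Finset.mem_image.1 hx
        simp [hev]
    by_cases hsmall : f.natDegree < p
    · refine ⟨C ((f %ₘ L).eval 0), ?_⟩
      rw [C_comp, ← hconst]
      symm
      rw [modByMonic_eq_self_iff hLm, degree_eq_natDegree hLm.ne_zero, hLd]
      exact lt_of_le_of_lt degree_le_natDegree (by exact_mod_cast hsmall)
    · obtain ⟨g, hg⟩ := ih (f /ₘ L) (by
        rw [natDegree_divByMonic _ hLm, hLd]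
        have := hp.pos
        omega) hq.symm
      refine ⟨C ((f %ₘ L).eval 0) + X * g, ?_⟩
      rw [add_comp, mul_comp, C_comp, X_comp, ← hg, ← hconst, h1]

open Polynomial in
lemma iterate_twist {R : Type*} [CommRing R] (φ : R →+* R) (a : R) (f : R[X])
    (h : (f.map φ).comp (X + C a) = f) (k : ℕ) :
    (f.map (φ ^ k)).comp (X + C (∑ i ∈ Finset.range k, (φ ^ i) a)) = f := by
  induction k with
  | zero => simp [RingHom.one_def]
  | succ k ih =>
    have h2 : f.map (φ ^ k) = (f.map (φ ^ (k+1))).comp (X + C ((φ ^ k) a)) := by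
      conv_lhs => rw [← h]
      rw [map_comp, map_map]
      simp only [Polynomial.map_add, map_X, map_C]
      rfl
    conv_rhs => rw [← ih, h2]
    rw [comp_assoc, Finset.sum_range_succ]
    simp only [add_comp, X_comp, C_comp, C_add]
    congr 1
    ring

lemma sum_range_periodic {M : Type*} [AddCommMonoid M] (h : ℕ → M) (q : ℕ)
    (hq : ∀ i, h (i + q) = h i) (k : ℕ) :
    ∑ i ∈ Finset.range (q * k), h i = k • ∑ i ∈ Finset.range q, h i := by
  have hq' : ∀ k i, h (q * k + i) = h i := by
    intro k
    induction k with
    | zero => simp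
    | succ k ih => intro i; rw [← ih i, ← hq (q * k + i)]; congr 1; ring
  induction k with
  | zero => simp
  | succ k ih =>
    rw [Nat.mul_succ, Finset.sum_range_add, ih, succ_nsmul]
    congr 1
    exact Finset.sum_congr rfl fun i _ => hq' k i


open Polynomial in
lemma twist_step {R : Type*} [CommRing R] [IsDomain R] {p : ℕ} (hp : p.Prime)
    [CharP R p] (φ : R →+* R) (q : ℕ) (hφ : φ ^ q = 1) (a T : R)
    (hTdef : T = ∑ i ∈ Finset.range q, (φ ^ i) a) (hT : T ≠ 0) (f : R[X]) (hf : f.Monic)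
    (h : (f.map φ).comp (X + C a) = f) :
    ∃ g : R[X], g.Monic ∧ f.natDegree = p * g.natDegree ∧
      (g.map φ).comp (X + C (a ^ p - T ^ (p - 1) * a)) = g := by
  have : Fact p.Prime := ⟨hp⟩
  have h1 := iterate_twist _ _ _ h q
  rw [hφ, ← hTdef] at h1
  have h1' : f.comp (X + C T) = f := by simpa [RingHom.one_def] using h1
  have hφT : φ T = T := by
    have e1 : φ T + a = ∑ i ∈ Finset.range (q + 1), (φ ^ i) a := by
      rw [Finset.sum_range_succ', hTdef, map_sum]
      simp [pow_succ', RingHom.mul_def]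
    rw [Finset.sum_range_succ, ← hTdef, hφ] at e1
    simpa using e1
  obtain ⟨g, hg⟩ := exists_comp_of_translate hp T hT _ f (Nat.lt_succ_self _) h1'
  set L : R[X] := X ^ p - C (T ^ (p - 1)) * X with hL
  have hdeg : (C (T ^ (p - 1)) * X : R[X]).degree < (p : ℕ) := by
    refine lt_of_le_of_lt (degree_C_mul_X_le _) ?_
    exact_mod_cast hp.one_lt
  have hLm : L.Monic := monic_X_pow_sub hdeg
  have hLd : L.natDegree = p := by
    rw [hL]; apply natDegree_eq_of_degree_eq_some
    rw [degree_sub_eq_left_of_degree_lt] <;> rw [degree_X_pow]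
    exact hdeg
  have hLφ : L.map φ = L := by simp [hL, hφT]
  have hLa : L.comp (X + C a) = L + C (a ^ p - T ^ (p - 1) * a) := by
    simp only [hL, sub_comp, pow_comp, X_comp, mul_comp, C_comp]
    rw [add_pow_char]
    simp only [C_sub, C_mul, C_pow]
    ring
  refine ⟨g, ?_, ?_, ?_⟩
  · have := hf.leadingCoeff
    rw [hg, leadingCoeff_comp (by rw [hLd]; exact hp.ne_zero), hLm.leadingCoeff] at this
    simpa [Monic] using this
  · rw [hg, natDegree_comp, hLd, mul_comm]
  · have h2 : ((g.map φ).comp (X + C (a ^ p - T ^ (p - 1) * a))).comp L = g.comp L := by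
      conv_rhs => rw [← hg, ← h, hg, map_comp, hLφ, comp_assoc, hLa]
      rw [comp_assoc]; simp
    have h3 : ((g.map φ).comp (X + C (a ^ p - T ^ (p - 1) * a)) - g).comp L = 0 := by
      rw [sub_comp, h2, sub_self]
    rw [comp_eq_zero_iff] at h3
    rcases h3 with h3 | ⟨-, h3⟩
    · exact sub_eq_zero.1 h3
    · exfalso
      rw [h3, natDegree_C] at hLd
      exact hp.ne_zero hLd.symm

open MvPolynomial

/-- cyclic shift of the variables -/
noncomputable def shiftV (F : Type*) [Field F] (q : ℕ) :
    MvPolynomial (ZMod q) F →+* MvPolynomial (ZMod q) F :=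
  (rename (fun i => i + 1)).toRingHom

lemma shiftV_pow_X {F : Type*} [Field F] (q k : ℕ) (j : ZMod q) :
    ((shiftV F q) ^ k) (X j) = X (j + k) := by
  induction k generalizing j with
  | zero => simp
  | succ k ih =>
    rw [pow_succ, RingHom.mul_def, RingHom.comp_apply]
    have : shiftV F q (X j) = X (j + 1) := by simp [shiftV]
    rw [this, ih]; congr 1; push_cast; ring

lemma shiftV_pow_C {F : Type*} [Field F] (q k : ℕ) (c : F) :
    ((shiftV F q) ^ k) (C c) = C c := by
  induction k with
  | zero => simp
  | succ k ih =>
    rw [pow_succ, RingHom.mul_def, RingHom.comp_apply]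
    have : shiftV F q (C c) = C c := by simp [shiftV]
    rw [this, ih]

lemma shiftV_pow_self {F : Type*} [Field F] (q : ℕ) : (shiftV F q) ^ q = 1 := by
  apply MvPolynomial.ringHom_ext
  · intro c; rw [shiftV_pow_C]; rfl
  · intro i; rw [shiftV_pow_X]; simp


/-- reduction of indices of the variables -/
noncomputable def redV (F : Type*) [Field F] (p r : ℕ) :
    MvPolynomial (ZMod (p ^ (r + 1))) F →+* MvPolynomial (ZMod (p ^ r)) F :=
  (rename (ZMod.castHom (pow_dvd_pow p (Nat.le_succ r)) (ZMod (p ^ r)))).toRingHom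

lemma shift_sum_ne_zero {F : Type*} [Field F] {p : ℕ} (hp : p.Prime) (r P : ℕ) (hP : P ≠ 0) :
    ∑ i ∈ Finset.range (p ^ r), ((shiftV F (p ^ r)) ^ i) (X 0 ^ P) ≠ 0 := by
  have hq : 0 < p ^ r := pow_pos hp.pos r
  intro h
  have h2 := congrArg (eval (fun j : ZMod (p ^ r) => if j = 0 then (1 : F) else 0)) h
  rw [map_sum, map_zero, Finset.sum_eq_single 0] at h2
  · simp at h2
  · intro i hi h0
    rw [map_pow, shiftV_pow_X, map_pow, eval_X, if_neg, zero_pow hP]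
    rw [zero_add, ZMod.natCast_eq_zero_iff]
    intro hd
    exact absurd (Nat.le_of_dvd (Nat.pos_of_ne_zero h0) hd) (by
      have := Finset.mem_range.1 hi; omega)
  · intro h0; exact absurd (Finset.mem_range.2 hq) h0

lemma lower_main {F : Type*} [Field F] {p : ℕ} (hp : p.Prime) [CharP F p] :
    ∀ (r s : ℕ) (f : Polynomial (MvPolynomial (ZMod (p ^ r)) F)), f.Monic →
      (f.map (shiftV F (p ^ r))).comp (Polynomial.X + Polynomial.C (X 0 ^ (p ^ s))) = f →
      p ^ (r + 1) ∣ f.natDegree := by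
  have : Fact p.Prime := ⟨hp⟩
  intro r
  induction r with
  | zero =>
    intro s f hf h
    obtain ⟨g, -, hg, -⟩ := twist_step hp _ _ (shiftV_pow_self (p ^ 0)) _ _ rfl
      (shift_sum_ne_zero hp 0 _ (pow_ne_zero s hp.ne_zero)) f hf h
    rw [hg, zero_add, pow_one]
    exact dvd_mul_right _ _
  | succ r ih =>
    intro s f hf h
    obtain ⟨g, hgm, hg, hgt⟩ := twist_step hp _ _ (shiftV_pow_self (p ^ (r + 1))) _ _ rfl
      (shift_sum_ne_zero hp (r + 1) _ (pow_ne_zero s hp.ne_zero)) f hf h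
    rw [hg, pow_succ' p (r + 1)]
    apply mul_dvd_mul_left
    rw [← hgm.natDegree_map (redV F p r)]
    apply ih (s + 1) _ (hgm.map _)
    have hcomm : (redV F p r).comp (shiftV F (p ^ (r + 1))) =
        (shiftV F (p ^ r)).comp (redV F p r) := by
      apply MvPolynomial.ringHom_ext
      · intro c; simp [redV, shiftV]
      · intro i; simp [redV, shiftV, rename_X, -ZMod.castHom_apply]
    have hT : redV F p r (∑ i ∈ Finset.range (p ^ (r + 1)),
        ((shiftV F (p ^ (r + 1))) ^ i) (X 0 ^ p ^ s)) = 0 := by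
      have e : ∀ i : ℕ, redV F p r (((shiftV F (p ^ (r + 1))) ^ i) (X 0 ^ p ^ s)) =
          X (i : ZMod (p ^ r)) ^ p ^ s := by
        intro i
        rw [map_pow, shiftV_pow_X, map_pow]
        simp [redV, rename_X, -ZMod.castHom_apply]
      rw [map_sum, Finset.sum_congr rfl (fun i _ => e i), pow_succ,
        sum_range_periodic _ (p ^ r)]
      · rw [nsmul_eq_mul, CharP.cast_eq_zero, zero_mul]
      · intro i; simp
    have hp1 : p - 1 ≠ 0 := by have := hp.two_le; omega
    have hX : redV F p r (X 0) = X 0 := by simp [redV, rename_X, -ZMod.castHom_apply]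
    have h3 := congrArg (Polynomial.map (redV F p r)) hgt
    rw [Polynomial.map_comp, Polynomial.map_map, hcomm, ← Polynomial.map_map,
      Polynomial.map_add, Polynomial.map_X, Polynomial.map_C, map_sub, map_mul,
      map_pow (redV F p r) _ (p - 1), hT, zero_pow hp1, zero_mul, sub_zero, map_pow (redV F p r), map_pow (redV F p r), hX,
      ← pow_mul, ← pow_succ] at h3
    exact h3


section Link

lemma prod_coeff_aux {R ι : Type*} [CommRing R] (h : ι → Polynomial R) (m : ι → ℕ)
    (hd : ∀ i, (h i).natDegree ≤ 1) (s : Finset ι) :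
    (∏ i ∈ s, h i ^ m i).natDegree ≤ ∑ i ∈ s, m i ∧
    (∏ i ∈ s, h i ^ m i).coeff (∑ i ∈ s, m i) = ∏ i ∈ s, (h i).coeff 1 ^ m i := by
  classical
  induction s using Finset.induction_on with
  | empty => simp
  | insert a s ha ih =>
    have h1 : (h a ^ m a).natDegree ≤ m a := by
      simpa using Polynomial.natDegree_pow_le_of_le (m a) (hd a)
    have h2 : (h a ^ m a).coeff (m a) = (h a).coeff 1 ^ m a := by
      simpa using Polynomial.coeff_pow_of_natDegree_le (m := m a) (hd a)
    rw [Finset.prod_insert ha, Finset.sum_insert ha, Finset.prod_insert ha]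
    refine ⟨Polynomial.natDegree_mul_le_of_le h1 ih.1, ?_⟩
    rw [Polynomial.coeff_mul_add_eq_of_natDegree_le h1 ih.1, h2, ih.2]

lemma eval₂_coeff_aux {F R : Type*} [Field F] [CommRing R] (j : F →+* R) {n d : ℕ}
    (f : MvPolynomial (Fin n) F) (hf : f.IsHomogeneous d) (h : Fin n → Polynomial R)
    (v : Fin n → F) (hd : ∀ i, (h i).natDegree ≤ 1) (hv : ∀ i, (h i).coeff 1 = j (v i)) :
    (eval₂Hom (Polynomial.C.comp j) h f).natDegree ≤ d ∧
    (eval₂Hom (Polynomial.C.comp j) h f).coeff d = j (eval v f) := by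
  have key : ∀ m ∈ f.support, ∑ i, m i = d := by
    intro m hm
    have := hf (mem_support_iff.1 hm)
    rw [← this, ← Finsupp.degree_eq_sum, Finsupp.degree_eq_weight_one]
    rfl
  rw [coe_eval₂Hom, eval₂_eq', eval_eq']
  constructor
  · apply Polynomial.natDegree_sum_le_of_forall_le
    intro m hm
    have := (prod_coeff_aux h m hd Finset.univ).1
    rw [key m hm] at this
    simpa using (Polynomial.natDegree_C_mul_le _ _).trans this
  · rw [Polynomial.finsetSum_coeff, map_sum]
    refine Finset.sum_congr rfl fun m hm => ?_
    have := (prod_coeff_aux h m hd Finset.univ).2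
    rw [key m hm] at this
    rw [RingHom.comp_apply, Polynomial.coeff_C_mul, this]
    simp [hv]

/-- iterated differences of the first variable -/
noncomputable def diffV (F : Type*) [Field F] (q k : ℕ) : MvPolynomial (ZMod q) F :=
  (((rename (R := F) (fun i : ZMod q => i + 1)).toLinearMap - 1) ^ k : Module.End F _) (X 0)

lemma diffV_succ (F : Type*) [Field F] (q k : ℕ) :
    diffV F q (k + 1) = shiftV F q (diffV F q k) - diffV F q k := by
  rw [diffV, pow_succ']
  rfl

lemma charP_end (F M : Type*) [Field F] [AddCommGroup M] [Module F M] [Nontrivial M] (p : ℕ)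
    [CharP F p] : CharP (Module.End F M) p :=
  charP_of_injective_algebraMap (algebraMap F (Module.End F M)).injective p

lemma diffV_zero_of_ge (F : Type*) [Field F] {p : ℕ} (hp : p.Prime) [CharP F p] (r k : ℕ)
    (hk : p ^ r ≤ k) : diffV F (p ^ r) k = 0 := by
  have : Fact p.Prime := ⟨hp⟩
  have := charP_end F (MvPolynomial (ZMod (p ^ r)) F) p
  obtain ⟨l, rfl⟩ := Nat.exists_eq_add_of_le hk
  set L : Module.End F (MvPolynomial (ZMod (p ^ r)) F) :=
    (rename (R := F) (fun i : ZMod (p ^ r) => i + 1)).toLinearMap with hL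
  have hpow : ∀ k x, (L ^ k) x = ((shiftV F (p ^ r)) ^ k) x := by
    intro k
    induction k with
    | zero => intro x; simp
    | succ k ih =>
      intro x
      rw [pow_succ, pow_succ, Module.End.mul_apply, ih]
      rfl
  have h1 : L ^ p ^ r = 1 := by
    refine LinearMap.ext fun x => ?_
    rw [hpow, shiftV_pow_self]
    rfl
  have h0 : (L - 1) ^ p ^ r = 0 := by
    rw [sub_pow_char_pow_of_commute _ _ (Commute.one_right L), h1, one_pow, sub_self]
  rw [diffV, ← hL, pow_add, h0, zero_mul]
  rfl

/-- images of the variables, from the top one down -/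
noncomputable def imgV (F : Type*) [Field F] (q : ℕ) : ℕ → Polynomial (MvPolynomial (ZMod q) F)
  | 0 => Polynomial.X
  | k + 1 => Polynomial.C (diffV F q k)

/-- the twisted translation -/
noncomputable def twistV (F : Type*) [Field F] (q : ℕ) :
    Polynomial (MvPolynomial (ZMod q) F) →+* Polynomial (MvPolynomial (ZMod q) F) :=
  (Polynomial.compRingHom (Polynomial.X + Polynomial.C (X 0))).comp
    (Polynomial.mapRingHom (shiftV F q))

lemma twistV_imgV (F : Type*) [Field F] (q k : ℕ) :
    twistV F q (imgV F q k) = imgV F q k + imgV F q (k + 1) := by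
  cases k with
  | zero => simp [twistV, imgV, diffV]
  | succ k => simp [twistV, imgV, diffV_succ]

lemma lower_bound {F : Type*} [Field F] {p : ℕ} (hp : p.Prime) [CharP F p] (r n d : ℕ)
    (hn : p ^ r < n) (f : MvPolynomial (Fin n) F) (hinv : jordanAct n f = f)
    (hf : f.IsHomogeneous d)
    (hev : eval (fun i : Fin n => if (i : ℕ) = n - 1 then (1 : F) else 0) f ≠ 0) :
    p ^ (r + 1) ∣ d := by
  set v : Fin n → F := fun i : Fin n => if (i : ℕ) = n - 1 then (1 : F) else 0 with hv
  set f' := C (eval v f)⁻¹ * f with hf'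
  have hinv' : jordanAct n f' = f' := by
    rw [hf', map_mul, hinv]; congr 1; simp [jordanAct]
  have hev' : eval v f' = 1 := by simp [hf', hev]
  have hhom' : f'.IsHomogeneous d := by
    simpa using (isHomogeneous_C (Fin n) (eval v f)⁻¹).mul hf
  set q := p ^ r with hq
  set h : Fin n → Polynomial (MvPolynomial (ZMod q) F) := fun i => imgV F q (n - 1 - i) with hh
  set Θ := eval₂Hom (Polynomial.C.comp (C : F →+* MvPolynomial (ZMod q) F)) h with hΘ
  have hequiv : (twistV F q).comp Θ = Θ.comp (jordanAct n : _ →ₐ[F] _).toRingHom := by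
    apply MvPolynomial.ringHom_ext
    · intro c
      simp [hΘ, twistV, shiftV, jordanAct]
    · intro i
      have hi := i.isLt
      simp only [RingHom.comp_apply, hΘ, eval₂Hom_X', hh, twistV_imgV]
      simp only [jordanAct, AlgHom.toRingHom_eq_coe, RingHom.coe_coe, aeval_X, map_add,
        eval₂Hom_X']
      congr 1
      split_ifs with h0
      · rw [eval₂Hom_X']
        congr 1
        simp only
        omega
      · rw [map_zero]
        have : n - 1 - (i : ℕ) + 1 = (n - 1) + 1 := by omega
        rw [this, imgV, diffV_zero_of_ge F hp r _ (by omega), Polynomial.C_0]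
  obtain ⟨hdeg, hco⟩ := eval₂_coeff_aux (C : F →+* MvPolynomial (ZMod q) F) f' hhom' h v
    (by
      intro i
      simp only [hh]
      cases n - 1 - (i : ℕ) <;> simp [imgV])
    (by
      intro i
      have hi := i.isLt
      simp only [hh, hv]
      split_ifs with h0
      · rw [h0, Nat.sub_self]; simp [imgV]
      · obtain ⟨k, hk⟩ : ∃ k, n - 1 - (i : ℕ) = k + 1 := ⟨n - 1 - i - 1, by omega⟩
        rw [hk]; simp [imgV])
  rw [hev', map_one] at hco
  have hmon : (Θ f').Monic := Polynomial.monic_of_natDegree_le_of_coeff_eq_one d hdeg hco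
  have hnd : (Θ f').natDegree = d := by
    apply le_antisymm hdeg
    apply Polynomial.le_natDegree_of_ne_zero
    rw [hco]; exact one_ne_zero
  have ht : twistV F q (Θ f') = Θ f' := by
    have := RingHom.congr_fun hequiv f'
    rw [RingHom.comp_apply, RingHom.comp_apply] at this
    rw [this]
    congr 1
  rw [← hnd]
  apply lower_main hp r 0 _ hmon
  simpa [twistV] using ht

end Link

section Upper

lemma scalAct_homog {F : Type*} [Field F] (n d : ℕ) (lam : F) (f : MvPolynomial (Fin n) F)
    (hf : f.IsHomogeneous d) : scalAct n lam f = C (lam ^ d) * f := by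
  have key : ∀ m ∈ f.support, ∑ i, m i = d := by
    intro m hm
    have := hf (mem_support_iff.1 hm)
    rw [← this, ← Finsupp.degree_eq_sum, Finsupp.degree_eq_weight_one]
    rfl
  conv_rhs => rw [f.as_sum]
  rw [scalAct, aeval_def, eval₂_eq', Finset.mul_sum]
  refine Finset.sum_congr rfl fun m hm => ?_
  simp only [mul_pow, Finset.prod_mul_distrib]
  rw [Finset.prod_pow_eq_pow_sum, key m hm, monomial_eq, Finsupp.prod_fintype _ _ (by simp),
    map_pow, algebraMap_eq]
  ring

lemma jordan_homog {F : Type*} [Field F] (n j : ℕ) (i : Fin n) :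
    (((jordanAct (F := F) n) ^ j) (X i)).IsHomogeneous 1 := by
  induction j with
  | zero => simpa using isHomogeneous_X F i
  | succ j ih =>
    rw [pow_succ', AlgHom.mul_apply]
    have := ih.aeval (g := fun i : Fin n => X i + if _ : 0 < (i : ℕ) then
      (X ⟨(i : ℕ) - 1, lt_of_le_of_lt (Nat.sub_le _ _) i.isLt⟩ : MvPolynomial (Fin n) F) else 0)
      (n := 1) (by
        intro i
        apply (isHomogeneous_X F i).add
        split_ifs
        · exact isHomogeneous_X _ _
        · exact isHomogeneous_zero _ _ _)
    rw [one_mul] at this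
    exact this

lemma jordan_pow {F : Type*} [Field F] {p : ℕ} (hp : p.Prime) [CharP F p] (r n : ℕ)
    (hn : n ≤ p ^ r) (i : Fin n) : ((jordanAct (F := F) n) ^ (p ^ r)) (X i) = X i := by
  have : Fact p.Prime := ⟨hp⟩
  have := charP_end F (MvPolynomial (Fin n) F) p
  set L : Module.End F (MvPolynomial (Fin n) F) := (jordanAct n).toLinearMap with hL
  have hpow : ∀ k x, (L ^ k) x = ((jordanAct n) ^ k) x := by
    intro k
    induction k with
    | zero => intro x; simp
    | succ k ih =>
      intro x
      rw [pow_succ, pow_succ, Module.End.mul_apply, ih]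
      rfl
  have hnil : ∀ (k : ℕ) (i : Fin n), (i : ℕ) < k → ((L - 1) ^ k) (X i) = 0 := by
    intro k
    induction k with
    | zero => intro i hi; omega
    | succ k ih =>
      intro i hi
      rw [pow_succ, Module.End.mul_apply]
      have : (L - 1) (X i) = if _ : 0 < (i : ℕ) then
          (X ⟨(i : ℕ) - 1, lt_of_le_of_lt (Nat.sub_le _ _) i.isLt⟩ : MvPolynomial (Fin n) F)
          else 0 := by
        simp [hL, jordanAct]
      rw [this]
      split_ifs with h0
      · apply ih; simp only; omega
      · simp
  have h1 := hnil (p ^ r) i (lt_of_lt_of_le i.isLt hn)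
  rw [sub_pow_char_pow_of_commute _ _ (Commute.one_right L), one_pow, LinearMap.sub_apply,
    Module.End.one_apply, hpow] at h1
  exact sub_eq_zero.1 h1

lemma jordan_eval {F : Type*} [Field F] (n : ℕ) (i : Fin n) (j : ℕ) :
    ∀ (v : Fin n → F), (∀ k : Fin n, k < i → v k = 0) →
      eval v (((jordanAct (F := F) n) ^ j) (X i)) = v i := by
  induction j with
  | zero => intro v _; simp
  | succ j ih =>
    intro v hv
    set w : Fin n → F := fun k => v k + if _ : 0 < (k : ℕ) then
      v ⟨(k : ℕ) - 1, lt_of_le_of_lt (Nat.sub_le _ _) k.isLt⟩ else 0 with hw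
    have hcomp : ∀ g, eval v (jordanAct n g) = eval w g := by
      intro g
      have : (eval v).comp (jordanAct (F := F) n).toRingHom = eval w := by
        apply MvPolynomial.ringHom_ext
        · intro c; simp [jordanAct]
        · intro k
          simp only [RingHom.comp_apply, jordanAct, AlgHom.toRingHom_eq_coe, RingHom.coe_coe,
            aeval_X, map_add, eval_X, hw]
          congr 1
          split_ifs <;> simp
      exact RingHom.congr_fun this g
    have hlow : ∀ k : Fin n, k ≤ i → w k = v k := by
      intro k hk
      simp only [hw]
      split_ifs with h0
      · have hk' : (⟨(k : ℕ) - 1, lt_of_le_of_lt (Nat.sub_le _ _) k.isLt⟩ : Fin n) < i := by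
          rw [Fin.lt_def]
          rw [Fin.le_def] at hk
          simp only
          omega
        rw [hv _ hk', add_zero]
      · rw [add_zero]
    rw [pow_succ', AlgHom.mul_apply, hcomp, ih w, hlow i le_rfl]
    intro k hk
    rw [hlow k hk.le, hv k hk]

lemma upper_mem {F : Type*} [Field F] {p : ℕ} (hp : p.Prime) [CharP F p] (r m n : ℕ)
    (hm : 0 < m) (hn : n ≤ p ^ r) (lam : F) (hlam : lam ^ m = 1) (v : Fin n → F) (hv : v ≠ 0) :
    p ^ r * m ∈ {d : ℕ | 0 < d ∧ ∃ f : MvPolynomial (Fin n) F,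
      jordanAct n f = f ∧ scalAct n lam f = f ∧ f.IsHomogeneous d ∧ eval v f ≠ 0} := by
  classical
  have hne : ∃ i, v i ≠ 0 := by
    by_contra hcon
    push Not at hcon
    exact hv (funext hcon)
  obtain ⟨i, hi, hmin⟩ : ∃ i, v i ≠ 0 ∧ ∀ k : Fin n, k < i → v k = 0 := by
    obtain ⟨i, hi, hmin⟩ := WellFounded.has_min (wellFounded_lt (α := Fin n)) {i | v i ≠ 0} hne
    refine ⟨i, hi, fun k hk => ?_⟩
    by_contra hk0
    exact hmin k hk0 hk
  set N : MvPolynomial (Fin n) F :=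
    ∏ j ∈ Finset.range (p ^ r), ((jordanAct (F := F) n) ^ j) (X i) with hN
  have hNinv : jordanAct n N = N := by
    have e1 : jordanAct n N * X i =
        ∏ j ∈ Finset.range (p ^ r + 1), ((jordanAct (F := F) n) ^ j) (X i) := by
      rw [Finset.prod_range_succ', hN, map_prod]
      simp [pow_succ', AlgHom.mul_apply]
    rw [Finset.prod_range_succ, jordan_pow hp r n hn i] at e1
    exact mul_right_cancel₀ (X_ne_zero i) e1
  have hhom : (N ^ m).IsHomogeneous (p ^ r * m) := by
    apply IsHomogeneous.pow
    have := IsHomogeneous.prod (Finset.range (p ^ r))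
      (fun j => ((jordanAct (F := F) n) ^ j) (X i)) (fun _ => 1)
      (fun j _ => jordan_homog n j i)
    rw [Finset.sum_const, Finset.card_range, smul_eq_mul, mul_one] at this
    exact this
  refine ⟨Nat.mul_pos (pow_pos hp.pos r) hm, N ^ m, ?_, ?_, hhom, ?_⟩
  · rw [map_pow, hNinv]
  · rw [scalAct_homog n _ lam _ hhom, mul_comm (p ^ r) m, pow_mul, hlam, one_pow, C_1, one_mul]
  · rw [map_pow, hN, map_prod]
    apply pow_ne_zero
    rw [Finset.prod_ne_zero_iff]
    intro j _
    rw [jordan_eval n i j v hmin]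
    exact hi

end Upper

theorem stmt5 {F : Type*} [Field F] [IsAlgClosed F] {p : ℕ} (hp : p.Prime) [CharP F p]
    (r m n : ℕ) (hm : Nat.Coprime p m)
    (hn1 : p ^ (r - 1) < n) (hn2 : n ≤ p ^ r)
    (lam : F) (hlam : IsPrimitiveRoot lam m) :
    gammaW (F := F) n lam = p ^ r * m := by
  have hm0 : 0 < m := by
    rcases Nat.eq_zero_or_pos m with h | h
    · rw [h, Nat.coprime_zero_right] at hm
      exact absurd hm hp.one_lt.ne'
    · exact h
  have hr : r ≠ 0 := by
    rintro rfl
    simp at hn1 hn2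
    omega
  have hup : ∀ v : Fin n → F, v ≠ 0 → epsW n lam v ≤ p ^ r * m := fun v hv =>
    Nat.sInf_le (upper_mem hp r m n hm0 hn2 lam hlam.pow_eq_one v hv)
  have hn0 : 0 < n := by omega
  set v : Fin n → F := fun i : Fin n => if (i : ℕ) = n - 1 then (1 : F) else 0 with hv
  have hv0 : v ≠ 0 := by
    intro h
    have := congrFun h ⟨n - 1, by omega⟩
    simp [hv] at this
  have hlow : p ^ r * m ≤ epsW n lam v := by
    obtain ⟨hpos, f, hj, hs, hf, hev⟩ :=
      Nat.sInf_mem ⟨_, upper_mem hp r m n hm0 hn2 lam hlam.pow_eq_one v hv0⟩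
    change 0 < epsW n lam v at hpos
    change f.IsHomogeneous (epsW n lam v) at hf
    apply Nat.le_of_dvd hpos
    apply Nat.Coprime.mul_dvd_of_dvd_of_dvd (Nat.Coprime.pow_left r hm)
    · have := lower_bound hp (r - 1) n _ hn1 f hj hf hev
      rwa [Nat.sub_add_cancel (Nat.pos_of_ne_zero hr)] at this
    · apply hlam.dvd_of_pow_eq_one
      rw [scalAct_homog n _ lam f hf] at hs
      have h2 := congrArg (eval v) hs
      rw [map_mul, eval_C] at h2
      exact mul_right_cancel₀ hev (h2.trans (one_mul _).symm)
  unfold gammaW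
  apply le_antisymm
  · refine csSup_le ⟨epsW n lam v, v, hv0, rfl⟩ ?_
    rintro e ⟨w, hw, rfl⟩
    exact hup w hw
  · refine hlow.trans (le_csSup ⟨p ^ r * m, ?_⟩ ⟨v, hv0, rfl⟩)
    rintro e ⟨w, hw, rfl⟩
    exact hup w hw
end

section
/- Let $F$ be an algebraically closed field of characteristic $p > 0$, $\tilde G$ a finite $p$-group, $V$ a faithful finite-dimensional $\tilde G$-module, and $\sigma \in \tilde G$ an element of order $p^r$ such that $\sigma^{p^{r-1}}$ lies in the center $Z(\tilde G)$. Then $\delta(\tilde G, V) \ge p^r$. -/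
open MvPolynomial

/-- The action of a matrix `A` on polynomials, substituting each variable `X i`
by the linear form `∑ j, A i j • X j`, so that `(matAct A f)(v) = f(A ⬝ v)`. -/
noncomputable def matAct {F : Type*} [Field F] {N : ℕ} (A : Matrix (Fin N) (Fin N) F) :
    MvPolynomial (Fin N) F →ₐ[F] MvPolynomial (Fin N) F :=
  aeval fun i => ∑ j, C (A i j) * X j

/-- `f` is an invariant of the representation `ρ`: `σ(f) = f ∘ σ⁻¹ = f` for all `σ ∈ G`. -/
def IsInv {F : Type*} [Field F] {N : ℕ} {G : Type*} [Group G]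
    (ρ : G →* Matrix.GeneralLinearGroup (Fin N) F) (f : MvPolynomial (Fin N) F) : Prop :=
  ∀ σ : G, matAct ((ρ σ⁻¹ : Matrix.GeneralLinearGroup (Fin N) F) : Matrix (Fin N) (Fin N) F) f = f

/-- `v` is a fixed point of the representation `ρ`. -/
def IsFixedPt {F : Type*} [Field F] {N : ℕ} {G : Type*} [Group G]
    (ρ : G →* Matrix.GeneralLinearGroup (Fin N) F) (v : Fin N → F) : Prop :=
  ∀ σ : G, Matrix.mulVec ((ρ σ : Matrix.GeneralLinearGroup (Fin N) F) : Matrix (Fin N) (Fin N) F) v = v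

/-- `ε(G,v)`: minimal positive degree of a homogeneous invariant not vanishing at `v`. -/
noncomputable def epsGV {F : Type*} [Field F] {N : ℕ} {G : Type*} [Group G]
    (ρ : G →* Matrix.GeneralLinearGroup (Fin N) F) (v : Fin N → F) : ℕ :=
  sInf {d : ℕ | 0 < d ∧ ∃ f : MvPolynomial (Fin N) F,
    IsInv ρ f ∧ f.IsHomogeneous d ∧ eval v f ≠ 0}

/-- `δ(G,V)`: the degree of reductivity, i.e. the supremum of `ε(G,v)` over nonzero
fixed points `v` (and `0` if `V^G = {0}`). -/
noncomputable def deltaGV {F : Type*} [Field F] {N : ℕ} {G : Type*} [Group G]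
    (ρ : G →* Matrix.GeneralLinearGroup (Fin N) F) : ℕ :=
  sSup {e : ℕ | ∃ v : Fin N → F, v ≠ 0 ∧ IsFixedPt ρ v ∧ e = epsGV ρ v}



lemma powsum {Ω : Type*} [Field Ω] {p : ℕ} (hp : p.Prime) [CharP Ω p] (y : Ω) :
    ∑ a ∈ Finset.range p, (y + (a : Ω)) ^ (p - 1) = -1 := by
  have := Fact.mk hp
  let _ : Algebra (ZMod p) Ω := ZMod.algebra Ω p
  have h1 : ∀ m < p - 1, ∑ a ∈ Finset.range p, (a : Ω) ^ m = 0 := by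
    intro m hm
    have := FiniteField.sum_pow_lt_card_sub_one (ZMod p) m (by rwa [ZMod.card])
    have h2 := congrArg (algebraMap (ZMod p) Ω) this
    rw [map_sum, map_zero] at h2
    rw [← h2]
    refine Finset.sum_bij (fun a _ => (a : ZMod p)) (by simp) ?_ ?_ ?_
    · intro a ha b hb hab
      rw [ZMod.natCast_eq_natCast_iff'] at hab
      simp only [Finset.mem_range] at ha hb
      rwa [Nat.mod_eq_of_lt ha, Nat.mod_eq_of_lt hb] at hab
    · intro b _
      exact ⟨b.val, by simpa using ZMod.val_lt b, by simp⟩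
    · intro a _; simp
  have h2 : ∑ a ∈ Finset.range p, (a : Ω) ^ (p - 1) = -1 := by
    obtain ⟨n, hn⟩ : ∃ n, p = n + 1 := ⟨p - 1, by have := hp.one_lt; omega⟩
    have h3 : ∀ a ∈ Finset.range n, ((a + 1 : ℕ) : Ω) ^ (p - 1) = 1 := by
      intro a ha
      simp only [Finset.mem_range] at ha
      have h4 : ((a + 1 : ℕ) : ZMod p) ≠ 0 := by
        rw [Ne, ZMod.natCast_eq_zero_iff]
        exact fun h => absurd (Nat.le_of_dvd (by omega) h) (by omega)
      have := congrArg (algebraMap (ZMod p) Ω) (ZMod.pow_card_sub_one_eq_one h4)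
      simpa using this
    have e : ∑ a ∈ Finset.range p, (a : Ω) ^ (p - 1) = ∑ a ∈ Finset.range (n+1), (a : Ω) ^ (p - 1) := by
      rw [← hn]
    rw [e, Finset.sum_range_succ', Finset.sum_congr rfl h3]
    have h5 : (n : Ω) + 1 = 0 := by
      have := CharP.cast_eq_zero Ω p
      rw [hn] at this; push_cast at this; exact this
    have : p - 1 ≠ 0 := by have := hp.one_lt; omega
    simp [this]
    linear_combination h5
  simp_rw [add_pow]
  rw [Finset.sum_comm, Finset.sum_range_succ']
  rw [Finset.sum_eq_zero]
  · simp [h2]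
  · intro m hm
    simp only [Finset.mem_range] at hm
    rw [← Finset.sum_mul, ← Finset.mul_sum, h1 _ (by omega)]
    simp

section
variable {F Ω : Type*} [Field F] [Field Ω] [Algebra F Ω] {σ : Ω →ₐ[F] Ω}

lemma hilbert90 {n : ℕ} {β γ : Ω} (hβ : (σ ^ n) β = β)
    (hb : ∑ j ∈ Finset.range n, (σ ^ j) β = 1) (hc : ∑ j ∈ Finset.range n, (σ ^ j) γ = 0) :
    ∃ α, σ α - α = γ := by
  let S : ℕ → Ω := fun j => ∑ l ∈ Finset.range j, (σ ^ l) γ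
  have hS : ∀ j, σ (S j) = S (j+1) - γ := by
    intro j
    simp only [S]
    rw [Finset.sum_range_succ', map_sum]
    simp only [pow_succ', AlgHom.mul_apply]
    simp
  have hB : ∀ j, σ ((σ ^ j) β) = (σ ^ (j+1)) β := fun j => by rw [pow_succ', AlgHom.mul_apply]
  refine ⟨- ∑ j ∈ Finset.range n, S j * (σ ^ j) β, ?_⟩
  have h1 : ∑ j ∈ Finset.range n, (σ ^ (j+1)) β = 1 := by
    have h2 := Finset.sum_range_succ (fun j => (σ ^ j) β) n
    rw [Finset.sum_range_succ'] at h2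
    rw [hβ, hb] at h2
    simpa using h2
  have h3 : ∑ j ∈ Finset.range n, S (j+1) * (σ ^ (j+1)) β = ∑ j ∈ Finset.range n, S j * (σ ^ j) β := by
    have h2 := Finset.sum_range_succ (fun j => S j * (σ ^ j) β) n
    rw [Finset.sum_range_succ'] at h2
    have hSn : S n = 0 := hc
    have hS0 : S 0 = 0 := by simp [S]
    rw [hSn, hS0] at h2
    simpa only [zero_mul, add_zero] using h2
  rw [map_neg, map_sum]
  simp only [map_mul, hS, hB, sub_mul, Finset.sum_sub_distrib, ← Finset.mul_sum, h1, h3]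
  ring

lemma orbit_sum {y β : Ω} (c : Ω) (hc : σ c = c) (hy : σ y = y + β + c) (n : ℕ) :
    (σ ^ n) y = y + ∑ j ∈ Finset.range n, (σ ^ j) β + n * c := by
  induction n with
  | zero => simp
  | succ n ih =>
    rw [pow_succ', AlgHom.mul_apply, ih, Finset.sum_range_succ']
    simp only [map_add, map_mul, map_sum, hy, hc, pow_succ', AlgHom.mul_apply, map_natCast]
    simp; ring

lemma exists_as [IsAlgClosed Ω] {p : ℕ} (hp : p.Prime) (α : Ω) : ∃ y : Ω, y ^ p - y = α := by
  have hd : (Polynomial.X ^ p - (Polynomial.X + Polynomial.C α) : Polynomial Ω).degree = p := by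
    rw [Polynomial.degree_sub_eq_left_of_degree_lt] <;> rw [Polynomial.degree_X_pow]
    rw [Polynomial.degree_X_add_C]
    exact_mod_cast hp.one_lt
  obtain ⟨y, hy⟩ := IsAlgClosed.exists_root _ (by rw [hd]; exact_mod_cast hp.ne_zero)
  refine ⟨y, ?_⟩
  simp [Polynomial.IsRoot] at hy
  linear_combination hy

lemma fix_of_pow {p : ℕ} (hp : p.Prime) [CharP Ω p] {c : Ω} (hcp : c ^ p = c) : σ c = c := by
  have := Fact.mk hp
  -- c is in the prime field
  have hroot : ∃ a : ZMod p, (ZMod.castHom dvd_rfl Ω) a = c := by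
    by_contra! hno
    let P : Polynomial Ω := Polynomial.X ^ p - Polynomial.X
    have hP : P ≠ 0 := FiniteField.X_pow_card_sub_X_ne_zero Ω hp.one_lt
    have hdeg : P.natDegree = p := FiniteField.X_pow_card_sub_X_natDegree_eq Ω hp.one_lt
    classical
    let s : Finset Ω := insert c (Finset.univ.image (ZMod.castHom (dvd_refl p) Ω))
    have hs : s.card = p + 1 := by
      rw [Finset.card_insert_of_notMem (by simpa using hno),
        Finset.card_image_of_injective _ (ZMod.castHom (dvd_refl p) Ω).injective]
      simp [ZMod.card]
    have hsub : s ⊆ P.roots.toFinset := by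
      intro a ha
      rw [Multiset.mem_toFinset, Polynomial.mem_roots hP]
      rcases Finset.mem_insert.mp ha with rfl | ha
      · simp [P, Polynomial.IsRoot, hcp]
      · obtain ⟨b, -, rfl⟩ := Finset.mem_image.mp ha
        simp only [P, Polynomial.IsRoot, Polynomial.eval_sub, Polynomial.eval_pow,
          Polynomial.eval_X]
        rw [← map_pow, ZMod.pow_card, sub_self]
    have h1 := Finset.card_le_card hsub
    have h2 := P.roots.toFinset_card_le
    have h3 := P.card_roots'
    omega
  obtain ⟨a, ha⟩ := hroot
  rw [← ha]
  exact congrFun (congrArg DFunLike.coe (Subsingleton.elim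
    ((σ : Ω →+* Ω).comp (ZMod.castHom (dvd_refl p) Ω)) (ZMod.castHom (dvd_refl p) Ω))) a

lemma as_step1 [IsAlgClosed Ω] {p : ℕ} (hp : p.Prime) [CharP Ω p] {i : ℕ} (hi : 0 < i) {β : Ω}
    (hβ : (σ ^ (p ^ i)) β = β) (hb : ∑ j ∈ Finset.range (p ^ i), (σ ^ j) β = 1) :
    ∃ y, (σ ^ (p ^ i)) y = y + 1 := by
  have := Fact.mk hp
  obtain ⟨α, hα⟩ := hilbert90 (γ := β ^ p - β) hβ hb (by
    simp only [map_sub, map_pow, Finset.sum_sub_distrib, hb]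
    rw [← sum_pow_char p, hb]; simp)
  obtain ⟨y, hy⟩ := exists_as hp α
  refine ⟨y, ?_⟩
  set c := σ y - y - β with hcdef
  have hcp : c ^ p = c := by
    have := congrArg σ hy
    rw [map_sub, map_pow] at this
    rw [hcdef, sub_pow_char, sub_pow_char]
    linear_combination this - hy + hα
  have hc : σ c = c := fix_of_pow hp hcp
  rw [orbit_sum (β := β) c hc (by rw [hcdef]; ring) (p ^ i), hb]
  have : ((p ^ i : ℕ) : Ω) = 0 := by
    rw [Nat.cast_pow, CharP.cast_eq_zero, zero_pow hi.ne']
  rw [this]; ring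

lemma as_step2 {p : ℕ} (hp : p.Prime) [CharP Ω p] {i : ℕ} {β y : Ω}
    (hβ : (σ ^ (p ^ i)) β = β) (hb : ∑ j ∈ Finset.range (p ^ i), (σ ^ j) β = 1)
    (hy : (σ ^ (p ^ i)) y = y + 1) :
    ∃ β', (σ ^ (p ^ (i+1))) β' = β' ∧ ∑ j ∈ Finset.range (p ^ (i+1)), (σ ^ j) β' = 1 := by
  have hym : ∀ m : ℕ, ((σ ^ (p ^ i)) ^ m) y = y + m := by
    intro m
    induction m with
    | zero => simp
    | succ m ih =>
      rw [pow_succ, AlgHom.mul_apply, hy, map_add, ih, map_one]; push_cast; ring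
  have hβm : ∀ m : ℕ, ((σ ^ (p ^ i)) ^ m) β = β := by
    intro m
    induction m with
    | zero => simp
    | succ m ih => rw [pow_succ, AlgHom.mul_apply, hβ, ih]
  refine ⟨-(β * y ^ (p - 1)), ?_, ?_⟩
  · rw [pow_succ, pow_mul, map_neg, map_mul, map_pow, hym, hβm]; simp
  · have h1 : ∀ a : ℕ, ((σ ^ (p ^ i)) ^ a) (-(β * y ^ (p - 1))) = -(β * (y + a) ^ (p - 1)) := by
      intro a; rw [map_neg, map_mul, map_pow, hym, hβm]
    have h2 : ∑ a ∈ Finset.range p, ((σ ^ (p ^ i)) ^ a) (-(β * y ^ (p - 1))) = β := by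
      simp only [h1]
      rw [Finset.sum_neg_distrib, ← Finset.mul_sum, powsum hp]; ring
    have h3 : ∀ (n m : ℕ) (x : Ω), ∑ j ∈ Finset.range (n * m), (σ ^ j) x =
        ∑ j ∈ Finset.range n, (σ ^ j) (∑ a ∈ Finset.range m, ((σ ^ n) ^ a) x) := by
      intro n m x
      induction m with
      | zero => simp
      | succ m ih =>
        rw [Nat.mul_succ, Finset.sum_range_add, ih]
        simp only [Finset.sum_range_succ, map_add, Finset.sum_add_distrib]
        congr 1
        refine Finset.sum_congr rfl fun j _ => ?_
        rw [add_comm, pow_add, AlgHom.mul_apply, pow_mul]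
    rw [pow_succ, h3, h2, hb]

lemma as_tower [IsAlgClosed Ω] {p : ℕ} (hp : p.Prime) [CharP Ω p] {y : Ω} (hy : σ y = y + 1) (i : ℕ) :
    ∃ y, (σ ^ (p ^ i)) y = y + 1 := by
  have key : ∀ i, (∃ β, (σ ^ (p ^ i)) β = β ∧ ∑ j ∈ Finset.range (p ^ i), (σ ^ j) β = 1) ∧
      ∃ y, (σ ^ (p ^ i)) y = y + 1 := by
    intro i
    induction i with
    | zero => exact ⟨⟨1, by simp, by simp⟩, y, by simpa using hy⟩
    | succ i ih =>
      obtain ⟨⟨β, h1, h2⟩, y, h3⟩ := ih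
      obtain ⟨β', h4, h5⟩ := as_step2 hp h1 h2 h3
      exact ⟨⟨β', h4, h5⟩, as_step1 hp (Nat.succ_pos i) h4 h5⟩
  exact (key i).2

end


structure VD {F Ω : Type*} [Field F] [Field Ω] [Algebra F Ω] (nrm : AbsoluteValue Ω ℝ)
    (σ : Ω →ₐ[F] Ω) : Prop where
  add : ∀ x y, nrm (x + y) ≤ max (nrm x) (nrm y)
  inv : ∀ x, nrm (σ x) = nrm x
  res : ∀ x, nrm x ≤ 1 → ∃ c : F, nrm (x - algebraMap F Ω c) < 1
  cst : ∀ c : F, c ≠ 0 → nrm (algebraMap F Ω c) = 1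

namespace VD
variable {F Ω : Type*} [Field F] [Field Ω] [Algebra F Ω] {nrm : AbsoluteValue Ω ℝ}
    {σ : Ω →ₐ[F] Ω}

lemma sub (h : VD nrm σ) (x y : Ω) : nrm (x - y) ≤ max (nrm x) (nrm y) := by
  rw [sub_eq_add_neg, ← nrm.map_neg y]; exact h.add _ _

lemma sub_lt (h : VD nrm σ) {x y : Ω} {e : ℝ} (hx : nrm x < e) (hy : nrm y < e) :
    nrm (x - y) < e := (h.sub x y).trans_lt (max_lt hx hy)

lemma add_lt (h : VD nrm σ) {x y : Ω} {e : ℝ} (hx : nrm x < e) (hy : nrm y < e) :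
    nrm (x + y) < e := (h.add x y).trans_lt (max_lt hx hy)

lemma cst_le (h : VD nrm σ) (c : F) : nrm (algebraMap F Ω c) ≤ 1 := by
  by_cases hc : c = 0
  · simp [hc]
  · exact (h.cst c hc).le

lemma eq_of_sub_lt (h : VD nrm σ) {x y : Ω} (hxy : nrm (x - y) < nrm y) : nrm x = nrm y := by
  apply le_antisymm
  · have := h.add (x - y) y
    rw [sub_add_cancel] at this
    exact this.trans (max_le hxy.le le_rfl)
  · by_contra! hc
    have := h.sub_lt hc hxy
    simp at this

/-- general residue -/
lemma res' (h : VD nrm σ) {x y : Ω} (hy : y ≠ 0) (hxy : nrm x ≤ nrm y) :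
    ∃ c : F, nrm (x - algebraMap F Ω c * y) < nrm y := by
  have hy' : 0 < nrm y := nrm.pos hy
  obtain ⟨c, hc⟩ := h.res (x / y) (by rw [map_div₀]; exact div_le_one_of_le₀ hxy hy'.le)
  refine ⟨c, ?_⟩
  have : x - algebraMap F Ω c * y = (x / y - algebraMap F Ω c) * y := by field_simp
  rw [this, map_mul]
  nlinarith

lemma pow (h : VD nrm σ) (n : ℕ) : VD nrm (σ ^ n) where
  add := h.add
  inv := by
    induction n with
    | zero => simp
    | succ n ih => intro x; rw [pow_succ, AlgHom.mul_apply, ih, h.inv]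
  res := h.res
  cst := h.cst

lemma one_lt (h : VD nrm σ) {x : Ω} (hx : σ x = x + 1) : 1 < nrm x := by
  by_contra! hc
  obtain ⟨c, hc⟩ := h.res x hc
  have h1 : nrm (σ (x - algebraMap F Ω c)) < 1 := by rwa [h.inv]
  have := h.sub_lt h1 hc
  rw [map_sub σ, hx, AlgHom.commutes] at this
  simp at this

lemma D_le (h : VD nrm σ) (x : Ω) : nrm (σ x - x) ≤ nrm x := by
  simpa [h.inv] using h.sub (σ x) x

/-- the operator σ - 1 -/
def D (σ : Ω →ₐ[F] Ω) : Ω →ₗ[F] Ω := σ.toLinearMap - 1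

lemma D_apply (x : Ω) : D σ x = σ x - x := rfl

lemma Dpow_le (h : VD nrm σ) (n : ℕ) (x : Ω) : nrm ((D σ ^ n) x) ≤ nrm x := by
  induction n with
  | zero => simp
  | succ n ih => rw [pow_succ']; exact (h.D_le _).trans ih

lemma D_lt (h : VD nrm σ) {x : Ω} (hx : x ≠ 0) {n : ℕ} (hn : (D σ ^ n) x = 0) :
    nrm (D σ x) < nrm x := by
  obtain ⟨c, hc⟩ := h.res' hx (h.D_le x)
  have key : ∀ n : ℕ, nrm ((D σ ^ n) x - algebraMap F Ω (c ^ n) * x) < nrm x := by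
    intro n
    induction n with
    | zero => simpa using nrm.pos hx
    | succ n ih =>
      have e : (D σ ^ (n+1)) x - algebraMap F Ω (c ^ (n+1)) * x =
        D σ ((D σ ^ n) x - algebraMap F Ω (c ^ n) * x)
          + algebraMap F Ω (c ^ n) * (σ x - x - algebraMap F Ω c * x) := by
        rw [pow_succ', map_sub, ← Algebra.smul_def (c ^ n) x, map_smul]
        simp only [Algebra.smul_def, D_apply, Module.End.mul_apply, map_pow, map_mul, pow_succ]
        ring
      rw [e]
      refine h.add_lt ((h.D_le _).trans_lt ih) ?_
      rw [map_mul]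
      refine lt_of_le_of_lt ?_ hc
      exact mul_le_of_le_one_left (apply_nonneg _ _) (h.cst_le _)
  have := key n
  have hc0 : c = 0 := by
    by_contra hc0
    rw [hn, zero_sub, nrm.map_neg, map_mul, h.cst _ (pow_ne_zero _ hc0)] at this
    simp at this
  subst hc0
  simpa [D_apply] using hc

lemma Dpow_lt (h : VD nrm σ) {x : Ω} (hx : x ≠ 0) {n : ℕ} (hn : (D σ ^ n) x = 0)
    {j : ℕ} (hj : 0 < j) : nrm ((D σ ^ j) x) < nrm x := by
  obtain ⟨j, rfl⟩ := Nat.exists_eq_succ_of_ne_zero hj.ne'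
  rw [Nat.succ_eq_add_one, pow_succ]
  exact (h.Dpow_le j _).trans_lt (h.D_lt hx hn)

lemma int_lemma {p : ℕ} (hp : p.Prime) {A : AddSubgroup ℤ} {g a : ℤ} (hg : g ∉ A)
    (hpg : (p : ℤ) * g ∈ A) (ha : a ∈ A) (k : ℕ) (hk : (p : ℤ) ^ k ∣ g) : (p : ℤ) ^ (k+1) ∣ a := by
  obtain ⟨n, rfl⟩ := Int.subgroup_cyclic A |>.imp fun n hn => hn
  simp only [← AddSubgroup.zmultiples_eq_closure, Int.mem_zmultiples_iff] at *
  refine dvd_trans ?_ ha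
  obtain ⟨m, hm⟩ := hpg
  have : (p : ℤ) ∣ n * m := ⟨g, hm.symm⟩
  have hpp : Prime (p : ℤ) := Nat.prime_iff_prime_int.mp hp
  have hm' : ¬ (p : ℤ) ∣ m := by
    rintro ⟨m', rfl⟩
    apply hg
    refine ⟨m', ?_⟩
    have := hpp.ne_zero
    apply mul_left_cancel₀ this
    rw [hm]; ring
  have h2 : (p : ℤ) ^ (k+1) ∣ n * m := by
    rw [← hm, pow_succ']; exact mul_dvd_mul_left _ hk
  exact (hpp.coprime_iff_not_dvd.mpr hm').pow_left.dvd_of_dvd_mul_right h2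

lemma int_chain {p : ℕ} (hp : p.Prime) (A : ℕ → AddSubgroup ℤ) (z : ℕ → ℤ) (s : ℕ)
    (h0 : ∀ i ≤ s, z i ∉ A i) (h1 : ∀ i ≤ s, (p : ℤ) * z i ∈ A i) (h2 : ∀ i ≤ s, z i ∈ A (i + 1))
    (d : ℕ) (hd : (d : ℤ) * z s ∈ A 0) : p ^ (s + 1) ∣ d := by
  have hpp : Prime (p : ℤ) := Nat.prime_iff_prime_int.mp hp
  have hz : z s ≠ 0 := fun h => h0 s le_rfl (h ▸ zero_mem _)
  have hfin : FiniteMultiplicity (p : ℤ) (z s) :=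
    Int.finiteMultiplicity_iff.mpr ⟨by simpa using hp.ne_one, hz⟩
  obtain ⟨c, hc, hc'⟩ := hfin.exists_eq_pow_mul_and_not_dvd
  set k := multiplicity (p : ℤ) (z s)
  have key : ∀ m ≤ s, (p : ℤ) ^ (k + m) ∣ z (s - m) := by
    intro m
    induction m with
    | zero => intro _; simpa using Dvd.intro _ hc.symm
    | succ m ih =>
      intro hm
      have := ih (by omega)
      refine int_lemma hp (h0 (s - m) (by omega)) (h1 _ (by omega)) ?_ _ this
      have := h2 (s - (m+1)) (by omega)
      rwa [show s - (m + 1) + 1 = s - m by omega] at this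
  have h3 := int_lemma hp (h0 0 (by omega)) (h1 0 (by omega)) hd (k + s) (by simpa using key s le_rfl)
  rw [hc, show k + s + 1 = k + (s+1) by ring, pow_add,
    show (d : ℤ) * ((p : ℤ) ^ k * c) = (p : ℤ) ^ k * (d * c) by ring,
    mul_dvd_mul_iff_left (pow_ne_zero _ hpp.ne_zero)] at h3
  have h4 := (hpp.coprime_iff_not_dvd.mpr hc').pow_left.dvd_of_dvd_mul_right h3
  exact_mod_cast h4

lemma pow_sub_eq (h : VD nrm σ) {x : Ω} (hx : 1 < nrm x) {p : ℕ} (hp : 1 < p) :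
    nrm (x ^ p - x) = nrm x ^ p := by
  rw [← map_pow]
  apply h.eq_of_sub_lt
  rw [sub_sub_cancel_left, nrm.map_neg, map_pow]
  exact lt_self_pow₀ hx hp

lemma exists_min (h : VD nrm σ) {L : IntermediateField F Ω} {M : ℕ} (hM : 0 < M) {e : ℝ} (he : 1 < e)
    (disc : ∀ x ∈ L, x ≠ 0 → ∃ z : ℤ, nrm x ^ M = e ^ z) {y : Ω} (hy : y ∈ L) (hy1 : σ y = y + 1) :
    ∃ x ∈ L, σ x = x + 1 ∧ ∀ b ∈ L, σ b = b → nrm b ≠ nrm x := by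
  have hne : ∀ x, σ x = x + 1 → x ≠ 0 := by rintro x hx rfl; simp at hx
  have hb : ∀ z : ℤ, (∃ x ∈ L, σ x = x + 1 ∧ nrm x ^ M = e ^ z) → 0 ≤ z := by
    rintro z ⟨x, -, hx, hz⟩
    by_contra! hc
    have h1 : e ^ z < 1 := zpow_lt_one_of_neg₀ he hc
    have h2 := one_lt_pow₀ (h.one_lt hx) hM.ne'
    linarith
  obtain ⟨z0, hz0⟩ := disc y hy (hne y hy1)
  obtain ⟨z, ⟨x, hxL, hx, hz⟩, hmin⟩ := Int.exists_least_of_bdd ⟨0, hb⟩ ⟨z0, y, hy, hy1, hz0⟩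
  refine ⟨x, hxL, hx, fun b hbL hb1 hbx => ?_⟩
  have hb0 : b ≠ 0 := by rintro rfl; exact hne x hx (by simpa using hbx.symm)
  obtain ⟨c, hc⟩ := h.res' hb0 hbx.ge
  have h1 : σ (x - algebraMap F Ω c * b) = x - algebraMap F Ω c * b + 1 := by
    simp [hx, hb1]; ring
  have h2 : x - algebraMap F Ω c * b ∈ L := sub_mem hxL (mul_mem (L.algebraMap_mem c) hbL)
  obtain ⟨z', hz'⟩ := disc _ h2 (hne _ h1)
  have h3 := hmin z' ⟨_, h2, h1, hz'⟩
  have h4 : e ^ z ≤ e ^ z' := zpow_le_zpow_right₀ he.le h3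
  rw [← hz, ← hz', ← hbx] at h4
  have := pow_lt_pow_left₀ hc (apply_nonneg _ _) hM.ne'
  linarith

lemma value_lemma {p : ℕ} (hp : p.Prime) [CharP Ω p] (h : VD nrm σ) {L : IntermediateField F Ω} {M : ℕ}
    (hM : 0 < M) {e : ℝ} (he : 1 < e)
    (disc : ∀ x ∈ L, x ≠ 0 → ∃ z : ℤ, nrm x ^ M = e ^ z) (s : ℕ)
    (y : ℕ → Ω) (hy : ∀ i ≤ s, y i ∈ L) (hy1 : ∀ i ≤ s, (σ ^ (p ^ i)) (y i) = y i + 1) :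
    ∃ x ∈ L, (σ ^ (p ^ s)) x = x + 1 ∧ ∀ (a : Ω) (d : ℕ), a ∈ L → σ a = a → nrm a = nrm x ^ d →
      p ^ (s + 1) ∣ d := by
  haveI := Fact.mk hp
  have H : ∀ i, ∃ x, i ≤ s → (x ∈ L ∧ (σ ^ (p ^ i)) x = x + 1 ∧
      ∀ b ∈ L, (σ ^ (p ^ i)) b = b → nrm b ≠ nrm x) := by
    intro i
    by_cases hi : i ≤ s
    · obtain ⟨x, h1, h2, h3⟩ := (h.pow (p ^ i)).exists_min hM he disc (hy i hi) (hy1 i hi)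
      exact ⟨x, fun _ => ⟨h1, h2, h3⟩⟩
    · exact ⟨0, fun h => absurd h hi⟩
  choose x hx using H
  have hgt : ∀ i ≤ s, 1 < nrm (x i) := fun i hi => (h.pow (p ^ i)).one_lt (hx i hi).2.1
  have hne : ∀ i ≤ s, x i ≠ 0 := by
    intro i hi h0
    have := hgt i hi
    rw [h0] at this; simp at this; linarith
  have H2 : ∀ i, ∃ z : ℤ, i ≤ s → nrm (x i) ^ M = e ^ z := by
    intro i
    by_cases hi : i ≤ s
    · obtain ⟨z, hz⟩ := disc _ (hx i hi).1 (hne i hi)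
      exact ⟨z, fun _ => hz⟩
    · exact ⟨0, fun h => absurd h hi⟩
  choose z hz using H2
  have e0 : e ≠ 0 := by positivity
  let A : ℕ → AddSubgroup ℤ := fun i =>
    { carrier := {z | ∃ a ∈ L, a ≠ 0 ∧ (σ ^ (p ^ i)) a = a ∧ nrm a ^ M = e ^ z}
      zero_mem' := ⟨1, one_mem _, one_ne_zero, map_one _, by simp⟩
      add_mem' := by
        rintro _ _ ⟨a, h1, h2, h3, h4⟩ ⟨b, g1, g2, g3, g4⟩
        exact ⟨a * b, mul_mem h1 g1, mul_ne_zero h2 g2, by rw [map_mul, h3, g3],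
          by rw [map_mul, mul_pow, h4, g4, zpow_add₀ e0]⟩
      neg_mem' := by
        rintro _ ⟨a, h1, h2, h3, h4⟩
        exact ⟨a⁻¹, inv_mem h1, inv_ne_zero h2, by rw [map_inv₀, h3],
          by rw [map_inv₀, inv_pow, h4, zpow_neg]⟩ }
  refine ⟨x s, (hx s le_rfl).1, (hx s le_rfl).2.1, fun a d haL ha had => ?_⟩
  refine int_chain hp A z s ?_ ?_ ?_ d ?_
  · rintro i hi ⟨a, h1, h2, h3, h4⟩
    apply (hx i hi).2.2 a h1 h3
    rw [← hz i hi] at h4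
    exact (pow_left_inj₀ (apply_nonneg _ _) (apply_nonneg _ _) hM.ne').mp h4
  · intro i hi
    have hn := h.pow_sub_eq (hgt i hi) hp.one_lt
    refine ⟨x i ^ p - x i, sub_mem (pow_mem (hx i hi).1 _) (hx i hi).1, ?_, ?_, ?_⟩
    · intro h0
      rw [h0] at hn
      have := pow_pos (zero_lt_one.trans (hgt i hi)) p
      simp at hn
      linarith
    · rw [map_sub, map_pow, (hx i hi).2.1, add_pow_char]; ring
    · rw [hn, ← pow_mul, mul_comm, pow_mul, hz i hi, ← zpow_natCast, ← zpow_mul, mul_comm]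
  · intro i hi
    refine ⟨x i, (hx i hi).1, hne i hi, ?_, hz i hi⟩
    have : ∀ m : ℕ, ((σ ^ (p ^ i)) ^ m) (x i) = x i + m := by
      intro m
      induction m with
      | zero => simp
      | succ m ih =>
        rw [pow_succ, AlgHom.mul_apply, (hx i hi).2.1, map_add, ih, map_one]; push_cast; ring
    rw [pow_succ, pow_mul, this]; simp
  · refine ⟨a, haL, ?_, by simpa using ha, ?_⟩
    · rintro rfl
      have := pow_pos (zero_lt_one.trans (hgt s le_rfl)) d
      simp at had
      linarith
    · rw [had, ← pow_mul, mul_comm, pow_mul, hz s le_rfl, ← zpow_natCast, ← zpow_mul, mul_comm]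

end VD

section constr
open Polynomial in
lemma exists_moving {k Ω : Type*} [Field k] [Field Ω] [Algebra k Ω] [IsAlgClosure k Ω] {p : ℕ}
    (hp : p.Prime) [CharP k p] (S : k) (hS : ∀ a : k, a ^ p - a ≠ S) :
    ∃ (τ : Ω ≃ₐ[k] Ω) (y : Ω), τ y = y + 1 := by
  have := Fact.mk hp
  have : IsAlgClosed Ω := IsAlgClosure.isAlgClosed k
  have : Algebra.IsAlgebraic k Ω := IsAlgClosure.isAlgebraic
  have : CharP Ω p := charP_of_injective_algebraMap (algebraMap k Ω).injective p
  obtain ⟨y, hy⟩ := exists_as hp (algebraMap k Ω S)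
  have h_integral : IsIntegral k y := Algebra.IsIntegral.isIntegral y
  have hroot : Polynomial.aeval y (Polynomial.X ^ p - Polynomial.X - Polynomial.C S : k[X]) = 0 := by
    simp [hy]
  have hsep : (minpoly k y).Separable := by
    refine Separable.of_dvd ?_ (minpoly.dvd k y hroot)
    rw [separable_def]
    have : derivative (Polynomial.X ^ p - Polynomial.X - Polynomial.C S : k[X]) = -1 := by
      have hpk : (p : k) = 0 := CharP.cast_eq_zero k p
      rw [derivative_sub, derivative_sub, derivative_X_pow, hpk]
      simp
    rw [this]
    exact isCoprime_one_right.neg_right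
  obtain ⟨y', hy', hne⟩ : ∃ y', Polynomial.aeval y' (minpoly k y) = 0 ∧ y' ≠ y := by
    by_contra! hno
    have h1 := card_rootSet_eq_natDegree (K := Ω) hsep (IsAlgClosed.splits _)
    have h2 : Fintype.card ((minpoly k y).rootSet Ω) ≤ 1 := by
      rw [Fintype.card_le_one_iff]
      rintro ⟨a, ha⟩ ⟨b, hb⟩
      rw [mem_rootSet] at ha hb
      exact Subtype.ext ((hno a ha.2).trans (hno b hb.2).symm)
    have h3 := minpoly.natDegree_pos h_integral
    have h4 : (minpoly k y).natDegree = 1 := by omega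
    rw [minpoly.natDegree_eq_one_iff] at h4
    obtain ⟨a, ha⟩ := h4
    apply hS a
    apply (algebraMap k Ω).injective
    rw [map_sub, map_pow, ha, hy]
  obtain ⟨τ, hτ⟩ := Algebra.IsAlgebraic.isAlgebraic y |> fun h => minpoly.exists_algEquiv_of_root' (K := k) h hy'
  set c := τ y - y with hc
  have hc0 : c ≠ 0 := by rw [hc, hτ]; exact sub_ne_zero.mpr hne
  have hcp : c ^ p = c := by
    have := congrArg τ hy
    rw [map_sub, map_pow, AlgEquiv.commutes] at this
    rw [hc, sub_pow_char]
    linear_combination this - hy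
  have h5 : τ c = c := fix_of_pow (σ := (τ : Ω →ₐ[k] Ω)) hp hcp
  refine ⟨τ, y / c, ?_⟩
  rw [map_div₀, h5]
  field_simp
  rw [hc]; ring

variable {F : Type*} [Field F] [IsAlgClosed F] {k : Type*} [NontriviallyNormedField k]
  [CompleteSpace k] [IsUltrametricDist k] [Algebra F k]

/-- spectral absolute value on the algebraic closure -/
noncomputable def specAbs (k : Type*) [NontriviallyNormedField k]
    [CompleteSpace k] [IsUltrametricDist k] : AbsoluteValue (AlgebraicClosure k) ℝ where
  toFun := spectralNorm k (AlgebraicClosure k)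
  map_mul' x y := map_mul (spectralMulAlgNorm k (AlgebraicClosure k)) x y
  nonneg' x := spectralNorm_nonneg x
  eq_zero' x := ⟨fun h => eq_zero_of_map_spectralNorm_eq_zero h (Algebra.IsAlgebraic.isAlgebraic x),
    fun h => by rw [h]; exact spectralNorm_zero⟩
  add_le' x y := map_add_le_add (spectralMulAlgNorm k (AlgebraicClosure k)) x y

lemma specAbs_apply (x : AlgebraicClosure k) : specAbs k x = spectralNorm k _ x := rfl

lemma specAbs_add (x y : AlgebraicClosure k) :
    specAbs k (x + y) ≤ max (specAbs k x) (specAbs k y) := isNonarchimedean_spectralNorm x y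

lemma specAbs_ext (x : k) : specAbs k (algebraMap k _ x) = ‖x‖ := spectralNorm_extends x

lemma specAbs_sum {ι : Type*} (s : Finset ι) (f : ι → AlgebraicClosure k) {e : ℝ} (he : 0 < e)
    (h : ∀ i ∈ s, specAbs k (f i) < e) : specAbs k (∑ i ∈ s, f i) < e := by
  classical
  induction s using Finset.induction_on with
  | empty => simpa using he
  | insert a s ha ih =>
    rw [Finset.sum_insert ha]
    exact (specAbs_add _ _).trans_lt (max_lt (h a (by simp)) (ih fun i hi => h i (by simp [hi])))

open Polynomial in
lemma specAbs_res (hb : ∀ x : k, ‖x‖ ≤ 1 → ∃ c : F, ‖x - algebraMap F k c‖ < 1)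
    (x : AlgebraicClosure k) (hx : specAbs k x ≤ 1) :
    ∃ c : F, specAbs k (x - algebraMap F _ c) < 1 := by
  have h_integral : IsIntegral k x := Algebra.IsIntegral.isIntegral x
  have hm := minpoly.monic h_integral
  have h1 := (spectralValue_le_one_iff hm).1 hx
  choose c hc using fun n => hb _ (h1 n)
  set n := (minpoly k x).natDegree with hn
  let P : F[X] := Polynomial.X ^ n + ∑ i ∈ Finset.range n, Polynomial.C (c i) * Polynomial.X ^ i
  have hPm : P.Monic := by
    apply monic_X_pow_add
    refine (degree_sum_le _ _).trans_lt ?_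
    rw [Finset.sup_lt_iff (by exact_mod_cast WithBot.bot_lt_coe n)]
    intro i hi
    refine (degree_C_mul_X_pow_le _ _).trans_lt ?_
    exact_mod_cast Finset.mem_range.mp hi
  have hP : specAbs k (Polynomial.aeval x P) < 1 := by
    have h2 : Polynomial.aeval x P = Polynomial.aeval x P - Polynomial.aeval x (minpoly k x) := by rw [minpoly.aeval, sub_zero]
    have h3 : minpoly k x = Polynomial.X ^ n + ∑ i ∈ Finset.range n, Polynomial.C ((minpoly k x).coeff i) * Polynomial.X ^ i :=
      hm.as_sum
    rw [h2]
    have h4 : Polynomial.aeval x P - Polynomial.aeval x (Polynomial.X ^ n + ∑ i ∈ Finset.range n, Polynomial.C ((minpoly k x).coeff i) * Polynomial.X ^ i) =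
      ∑ i ∈ Finset.range n, algebraMap k _ (-((minpoly k x).coeff i - algebraMap F k (c i))) * x ^ i := by
      simp only [P, map_add, map_pow, Polynomial.aeval_X, map_sum, map_mul, Polynomial.aeval_C, map_neg, map_sub,
        ← IsScalarTower.algebraMap_apply]
      rw [add_sub_add_left_eq_sub, ← Finset.sum_sub_distrib]
      exact Finset.sum_congr rfl fun i _ => by ring
    rw [← h3] at h4
    rw [h4]
    refine specAbs_sum _ _ one_pos fun i _ => ?_
    rw [map_mul, specAbs_ext, norm_neg, map_pow]
    calc _ ≤ ‖(minpoly k x).coeff i - algebraMap F k (c i)‖ * 1 := by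
            gcongr
            exact pow_le_one₀ (AbsoluteValue.nonneg _ _) hx
      _ < 1 := by rw [mul_one]; exact hc i
  have hspl := IsAlgClosed.splits P
  rw [hspl.eq_prod_roots_of_monic hPm] at hP
  by_contra! hno
  rw [map_multiset_prod, map_multiset_prod, Multiset.map_map, Multiset.map_map] at hP
  revert hP
  rw [imp_false, not_lt]
  refine Multiset.induction_on (p := fun s => 1 ≤ (Multiset.map _ s).prod) P.roots (by simp) ?_
  intro a s ih
  rw [Multiset.map_cons, Multiset.prod_cons]
  refine one_le_mul_of_one_le_of_one_le ?_ ih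
  simpa using hno a

lemma specAbs_disc {r : ℝ} (hc : ∀ x : k, x ≠ 0 → ∃ z : ℤ, ‖x‖ = r ^ z)
    (L : IntermediateField k (AlgebraicClosure k)) [FiniteDimensional k L]
    (x : AlgebraicClosure k) (hxL : x ∈ L) (hx : x ≠ 0) :
    ∃ z : ℤ, specAbs k x ^ (Module.finrank k L).factorial = r ^ z := by
  have h_integral : IsIntegral k x := Algebra.IsIntegral.isIntegral x
  have h1 : specAbs k x = _ := spectralNorm.spectralNorm_eq_norm_coeff_zero_rpow k _ x
  have h0 : (minpoly k x).coeff 0 ≠ 0 := minpoly.coeff_zero_ne_zero h_integral hx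
  obtain ⟨z, hz⟩ := hc _ h0
  set n := (minpoly k x).natDegree with hn
  have hn0 : 0 < n := minpoly.natDegree_pos h_integral
  have h2 : specAbs k x ^ n = r ^ z := by
    rw [h1, one_div, Real.rpow_inv_natCast_pow (norm_nonneg _) hn0.ne', hz]
  have h3 : n ≤ Module.finrank k L := by
    have := minpoly.natDegree_le (A := k) (⟨x, hxL⟩ : L)
    rwa [← minpoly.algebraMap_eq (B' := AlgebraicClosure k) (algebraMap L (AlgebraicClosure k)).injective] at this
  obtain ⟨m, hm⟩ := Nat.dvd_factorial hn0 h3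
  refine ⟨z * m, ?_⟩
  rw [hm, pow_mul, h2, zpow_mul, zpow_natCast]

theorem constr {p : ℕ} (hp : p.Prime) [CharP F p]
    (ha : ∀ c : F, c ≠ 0 → ‖algebraMap F k c‖ = 1)
    (hb : ∀ x : k, ‖x‖ ≤ 1 → ∃ c : F, ‖x - algebraMap F k c‖ < 1)
    {r : ℝ} (hr : 1 < r) (hc : ∀ x : k, x ≠ 0 → ∃ z : ℤ, ‖x‖ = r ^ z)
    (S : k) (hS : ‖S‖ = r) :
    ∃ σ : AlgebraicClosure k →ₐ[F] AlgebraicClosure k, VD (specAbs k) σ ∧ (∃ y, σ y = y + 1) ∧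
      ∀ t : Finset (AlgebraicClosure k), ∃ L : IntermediateField F (AlgebraicClosure k),
        (∀ x ∈ t, x ∈ L) ∧ (∀ x ∈ L, σ x ∈ L) ∧ ∃ M > 0, ∃ e > (1 : ℝ), ∀ x ∈ L, x ≠ 0 →
          ∃ z : ℤ, (specAbs k x) ^ M = e ^ z := by
  have : CharP k p := charP_of_injective_algebraMap (algebraMap F k).injective p
  have hno : ∀ a : k, a ^ p - a ≠ S := by
    intro a h
    have hr1 : 1 < ‖a‖ := by
      by_contra! hle
      have h1 : ‖a ^ p - a‖ ≤ 1 := by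
        rw [sub_eq_add_neg]
        refine (IsUltrametricDist.norm_add_le_max _ _).trans (max_le ?_ (by rwa [norm_neg]))
        rw [norm_pow]; exact pow_le_one₀ (norm_nonneg _) hle
      rw [h, hS] at h1; linarith
    have h2 : ‖a ^ p - a‖ = ‖a ^ p‖ := by
      have h3 : ‖a‖ < ‖a ^ p‖ := by
        rw [norm_pow]; exact lt_self_pow₀ hr1 hp.one_lt
      rw [sub_eq_add_neg, IsUltrametricDist.norm_add_eq_max_of_norm_ne_norm (by rw [norm_neg]; exact h3.ne'),
        norm_neg, max_eq_left h3.le]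
    obtain ⟨z, hz⟩ := hc a (by rintro rfl; simp at hr1; linarith)
    rw [h, hS, norm_pow, hz, ← zpow_natCast, ← zpow_mul] at h2
    have h4 : (1 : ℤ) = z * p := by
      apply zpow_right_injective₀ (by linarith : 0 < r) hr.ne'
      simpa using h2
    have h5 : (p : ℤ) ∣ 1 := ⟨z, by rw [h4]; ring⟩
    have h6 := Int.natCast_dvd_natCast.mp (by simpa using h5 : (p : ℤ) ∣ (1 : ℕ))
    exact hp.one_lt.ne' (Nat.dvd_one.mp h6)
  obtain ⟨τ, y, hy⟩ := exists_moving (Ω := AlgebraicClosure k) hp S hno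
  refine ⟨((τ : AlgebraicClosure k →ₐ[k] AlgebraicClosure k)).restrictScalars F, ⟨specAbs_add, ?_, specAbs_res hb, ?_⟩, ⟨y, hy⟩, ?_⟩
  · intro x
    exact (spectralNorm_eq_of_equiv τ x).symm
  · intro c hc
    rw [IsScalarTower.algebraMap_apply F k, specAbs_ext, ha c hc]
  · intro t
    let K := IntermediateField.adjoin k (t : Set (AlgebraicClosure k))
    have : FiniteDimensional k K := IntermediateField.finiteDimensional_adjoin fun x _ => Algebra.IsIntegral.isIntegral x
    let L := IntermediateField.normalClosure k K (AlgebraicClosure k)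
    refine ⟨L.restrictScalars F, ?_, ?_, (Module.finrank k L).factorial, Nat.factorial_pos _, r, hr, ?_⟩
    · intro x hx
      exact (IntermediateField.le_normalClosure K) (IntermediateField.subset_adjoin _ _ hx)
    · intro x hx
      have hN : Normal k L := inferInstance
      exact (IntermediateField.normal_iff_forall_map_le'.1 hN τ) ⟨x, hx, rfl⟩
    · intro x hx hx0
      exact specAbs_disc hc L x hx hx0
end constr

section laurent
open scoped Valued NNReal WithZero
open LaurentSeries

lemma ls_rod (F : Type*) [Field F] :
    (Valued.v : Valuation (LaurentSeries F) ℤᵐ⁰).IsRankOneDiscrete :=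
  Valuation.IsRankOneDiscrete.mk' ((PowerSeries.idealX F).valuation (LaurentSeries F))

@[reducible]
noncomputable def lsRankOne (F : Type*) [Field F] :
    (Valued.v : Valuation (LaurentSeries F) ℤᵐ⁰).RankOne :=
  have := ls_rod F
  Valuation.IsRankOneDiscrete.rankOne _ (e := 2) (by norm_num)

@[reducible]
noncomputable def lsNNF (F : Type*) [Field F] : NontriviallyNormedField (LaurentSeries F) :=
  letI := lsRankOne F
  Valued.toNontriviallyNormedField (LaurentSeries F) ℤᵐ⁰

attribute [local instance] lsRankOne 
lemma ls_ultra (F : Type*) [Field F] : letI := lsNNF F; IsUltrametricDist (LaurentSeries F) :=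
  inferInstanceAs (@IsUltrametricDist (LaurentSeries F) (Valued.toNormedField (LaurentSeries F) ℤᵐ⁰).toDist)
attribute [local instance] lsNNF

lemma ls_complete (F : Type*) [Field F] : CompleteSpace (LaurentSeries F) :=
  LaurentSeries.instLaurentSeriesComplete 

lemma ls_norm {F : Type*} [Field F] (x : LaurentSeries F) :
   ‖x‖ = WithZeroMulInt.toNNReal (e := 2) (by norm_num) (Valued.v x) := by
  have := ls_rod F
  have := Valuation.IsRankOneDiscrete.valueGroup₀_equiv_withZeroMulInt_restrict_apply_of_surjective (LaurentSeries.valuation_surjective F) x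
  rw [← this]
  rfl

lemma ls_norm_zpow {F : Type*} [Field F] (x : LaurentSeries F) (z : ℤ) (h : Valued.v x = WithZero.exp z) :
    ‖x‖ = 2 ^ z := by
  rw [ls_norm, h, WithZeroMulInt.toNNReal_neg_apply _ (by simp)]
  have : WithZero.unzero (WithZero.exp_ne_zero (a := z)) = Multiplicative.ofAdd z := rfl
  rw [this]
  simp

lemma ls_norm_ex {F : Type*} [Field F] (x : LaurentSeries F) (hx : x ≠ 0) :
    ∃ z : ℤ, Valued.v x = WithZero.exp z ∧ ‖x‖ = 2 ^ z := by
  have hx : Valued.v x ≠ 0 := by simpa using hx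
  exact ⟨WithZero.log (Valued.v x), (WithZero.exp_log hx).symm, ls_norm_zpow x _ (WithZero.exp_log hx).symm⟩

theorem exists_VD.{u} (F : Type u) [Field F] [IsAlgClosed F] {p : ℕ} (hp : p.Prime) [CharP F p] :
    ∃ (Ω : Type u) (_ : Field Ω) (_ : Algebra F Ω) (nrm : AbsoluteValue Ω ℝ) (σ : Ω →ₐ[F] Ω),
      IsAlgClosed Ω ∧ VD nrm σ ∧ (∃ y, σ y = y + 1) ∧
      ∀ t : Finset Ω, ∃ L : IntermediateField F Ω,
        (∀ x ∈ t, x ∈ L) ∧ (∀ x ∈ L, σ x ∈ L) ∧ ∃ M > 0, ∃ e > (1 : ℝ), ∀ x ∈ L, x ≠ 0 →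
          ∃ z : ℤ, (nrm x) ^ M = e ^ z := by
  have := ls_ultra F
  have := ls_complete F
  have hC : ∀ c : F, algebraMap F (LaurentSeries F) c = HahnSeries.single 0 c := by
    intro c; rw [LaurentSeries.algebraMap_apply]; rfl
  have hle : ∀ x : LaurentSeries F, ∀ D : ℤ, ‖x‖ ≤ 2 ^ (-D) ↔ ∀ n : ℤ, n < D → x.coeff n = 0 := by
    intro x D
    rw [← LaurentSeries.valuation_le_iff_coeff_lt_eq_zero]
    by_cases hx : x = 0
    · simp [hx]
      positivity
    · obtain ⟨z, h1, h2⟩ := ls_norm_ex x hx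
      rw [h1, h2, WithZero.exp_le_exp, zpow_le_zpow_iff_right₀ (by norm_num)]
  refine (constr (F := F) (k := LaurentSeries F) hp ?_ ?_ (r := 2) (by norm_num) ?_
    (HahnSeries.single (-1) 1) ?_).elim
    fun σ h => ⟨AlgebraicClosure (LaurentSeries F), _, _, specAbs _, σ, inferInstance, h⟩
  · intro c hc
    apply le_antisymm
    · have := (hle (algebraMap F (LaurentSeries F) c) 0).2 ?_
      · simpa using this
      · intro n hn
        rw [hC, HahnSeries.coeff_single_of_ne hn.ne]
    · by_contra! hlt
      obtain ⟨z, h1, h2⟩ := ls_norm_ex (algebraMap F (LaurentSeries F) c) (by simpa using hc)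
      rw [h2, zpow_lt_one_iff_right₀ (by norm_num)] at hlt
      have := (hle (algebraMap F (LaurentSeries F) c) 1).1 ?_ 0 (by norm_num)
      · rw [hC] at this
        simp [hc] at this
      · rw [h2]; exact zpow_le_zpow_right₀ (by norm_num) (by omega)
  · intro x hx
    refine ⟨x.coeff 0, ?_⟩
    have := (hle (x - algebraMap F (LaurentSeries F) (x.coeff 0)) 1).2 ?_
    · refine this.trans_lt (by norm_num)
    · intro n hn
      rw [hC, HahnSeries.coeff_sub]
      rcases (show n ≤ 0 by omega).lt_or_eq with h | h
      · rw [HahnSeries.coeff_single_of_ne h.ne, (hle x 0).1 (by simpa using hx) n h, sub_zero]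
      · subst h; simp
  · intro x hx
    obtain ⟨z, -, h⟩ := ls_norm_ex x hx
    exact ⟨z, h⟩
  · rw [ls_norm_zpow _ 1 (by rw [LaurentSeries.valuation_single_zpow]; rfl)]; simp
end laurent

namespace VD
section poly
variable {F Ω : Type*} [Field F] [Field Ω] [Algebra F Ω] {nrm : AbsoluteValue Ω ℝ}
    {σ : Ω →ₐ[F] Ω}

lemma sum_lt (h : VD nrm σ) {ι : Type*} (s : Finset ι) (f : ι → Ω) {e : ℝ} (he : 0 < e)
    (hf : ∀ i ∈ s, nrm (f i) < e) : nrm (∑ i ∈ s, f i) < e := by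
  classical
  induction s using Finset.induction_on with
  | empty => simpa using he
  | insert a s ha ih =>
    rw [Finset.sum_insert ha]
    exact h.add_lt (hf a (by simp)) (ih fun i hi => hf i (by simp [hi]))

lemma aeval_close (h : VD nrm σ) {ι : Type*} {a b : ι → Ω} (ha : ∀ i, nrm (a i) ≤ 1)
    (hb : ∀ i, nrm (b i) ≤ 1) (hab : ∀ i, nrm (a i - b i) < 1) (f : MvPolynomial ι F) :
    nrm (aeval a f - aeval b f) < 1 ∧ nrm (aeval a f) ≤ 1 ∧ nrm (aeval b f) ≤ 1 := by
  induction f using MvPolynomial.induction_on with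
  | C c => simpa using h.cst_le c
  | add f g hf hg =>
    simp only [map_add]
    refine ⟨?_, (h.add _ _).trans (max_le hf.2.1 hg.2.1), (h.add _ _).trans (max_le hf.2.2 hg.2.2)⟩
    rw [add_sub_add_comm]
    exact h.add_lt hf.1 hg.1
  | mul_X f i hf =>
    simp only [map_mul, aeval_X]
    refine ⟨?_, mul_le_one₀ hf.2.1 (apply_nonneg _ _) (ha i),
      mul_le_one₀ hf.2.2 (apply_nonneg _ _) (hb i)⟩
    have : aeval a f * a i - aeval b f * b i =
      (aeval a f - aeval b f) * a i + aeval b f * (a i - b i) := by ring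
    rw [this]
    refine h.add_lt ?_ ?_
    · rw [map_mul]
      exact (mul_le_of_le_one_right (apply_nonneg _ _) (ha i)).trans_lt hf.1
    · rw [map_mul]
      exact (mul_le_of_le_one_left (apply_nonneg _ _) hf.2.2).trans_lt (hab i)

lemma aeval_mul_homog {ι : Type*} {f : MvPolynomial ι F} {d : ℕ} (hf : f.IsHomogeneous d) (x : Ω)
    (u : ι → Ω) : aeval (fun i => x * u i) f = x ^ d * aeval u f := by
  rw [aeval_def, aeval_def, eval₂_eq, eval₂_eq, Finset.mul_sum]
  refine Finset.sum_congr rfl fun m hm => ?_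
  have : ∑ i ∈ m.support, m i = d := by
    have := hf (mem_support_iff.mp hm)
    rw [Finsupp.weight_apply] at this
    simpa [Finsupp.sum] using this
  simp only [mul_pow, Finset.prod_mul_distrib]
  rw [Finset.prod_pow_eq_pow_sum, this]
  ring

lemma Dpow_char {p : ℕ} (hp : p.Prime) [CharP F p] (s : ℕ) (x : Ω) :
    (D σ ^ (p ^ s)) x = (σ ^ (p ^ s)) x - x := by
  have := Fact.mk hp
  have : CharP (Module.End F Ω) p :=
    charP_of_injective_algebraMap (FaithfulSMul.algebraMap_injective F (Module.End F Ω)) p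
  have h1 : ∀ n : ℕ, (σ.toLinearMap ^ n : Module.End F Ω) = (σ ^ n).toLinearMap := by
    intro n
    induction n with
    | zero => rfl
    | succ n ih => rw [pow_succ, pow_succ, ih]; rfl
  have h2 : D σ ^ (p ^ s) = (σ.toLinearMap ^ (p ^ s) : Module.End F Ω) - 1 ^ (p ^ s) :=
    sub_pow_expChar_pow_of_commute p s (Commute.one_right (σ.toLinearMap : Module.End F Ω))
  rw [h2, h1, one_pow]; rfl

lemma u_eq {N : ℕ} (A : Matrix (Fin N) (Fin N) F) (q : ℕ) (W : ℕ → Fin N → F)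
    (hW : ∀ m, A.mulVec (W m) = W m + W (m + 1)) (hWq : W (q + 1) = 0)
    (X : ℕ → Ω) (hX : ∀ j, σ (X j) = X j + X (j + 1)) (hXq : X (q + 1) = 0) (i : Fin N) :
    σ (∑ j ∈ Finset.range (q + 1), X j * algebraMap F Ω (W (q - j) i)) =
      ∑ l, algebraMap F Ω (A i l) * ∑ j ∈ Finset.range (q + 1), X j * algebraMap F Ω (W (q - j) l) := by
  have h1 : ∀ m, ∑ l, algebraMap F Ω (A i l) * algebraMap F Ω (W m l) =
      algebraMap F Ω (W m i) + algebraMap F Ω (W (m + 1) i) := by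
    intro m
    have := congrFun (hW m) i
    rw [← map_add]
    change _ = algebraMap F Ω ((W m + W (m + 1)) i)
    rw [← this, Matrix.mulVec, dotProduct, map_sum]
    simp
  simp only [Finset.mul_sum]
  rw [Finset.sum_comm]
  have h2 : ∀ j, ∑ l, algebraMap F Ω (A i l) * (X j * algebraMap F Ω (W (q - j) l)) =
      X j * algebraMap F Ω (W (q - j) i) + X j * algebraMap F Ω (W (q - j + 1) i) := by
    intro j
    rw [← mul_add, ← h1, Finset.mul_sum]
    exact Finset.sum_congr rfl fun l _ => by ring
  simp only [h2, map_sum, map_mul, hX, AlgHom.commutes, add_mul, Finset.sum_add_distrib]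
  congr 1
  rw [Finset.sum_range_succ, hXq, Finset.sum_range_succ', Nat.sub_zero, hWq]
  simp only [zero_mul, Pi.zero_apply, map_zero, mul_zero, add_zero]
  refine Finset.sum_congr rfl fun j hj => ?_
  rw [Finset.mem_range] at hj
  rw [show q - (j + 1) + 1 = q - j by omega]

lemma aeval_mem_L (L : IntermediateField F Ω) {ι : Type*} {u : ι → Ω} (hu : ∀ i, u i ∈ L)
    (f : MvPolynomial ι F) : aeval u f ∈ L := by
  induction f using MvPolynomial.induction_on with
  | C c => simp
  | add f g hf hg => rw [map_add]; exact add_mem hf hg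
  | mul_X f i hf => rw [map_mul, aeval_X]; exact mul_mem hf (hu i)

end poly

theorem dvd_claim {F : Type*} [Field F] [IsAlgClosed F] {p : ℕ} (hp : p.Prime) [CharP F p]
    {N : ℕ} (A : Matrix (Fin N) (Fin N) F) (s : ℕ) (w v : Fin N → F)
    (hv : ((A - 1) ^ (p ^ s)).mulVec w = v) (hAv : A.mulVec v = v)
    (f : MvPolynomial (Fin N) F) (d : ℕ) (hf : f.IsHomogeneous d) (hinv : matAct A f = f)
    (hfv : eval v f ≠ 0) : p ^ (s + 1) ∣ d := by
  classical
  obtain ⟨Ω, _, _, nrm, σ, hcl, h, ⟨y0, hy0⟩, hL⟩ := exists_VD F hp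
  have : CharP Ω p := charP_of_injective_algebraMap (algebraMap F Ω).injective p
  choose y hy using as_tower hp hy0
  obtain ⟨L, hLt, hLσ, M, hM, e, he, disc⟩ := hL ((Finset.range (s + 1)).image y)
  obtain ⟨x, hxL, hx1, hx2⟩ := value_lemma hp h hM he disc s y
    (fun i hi => hLt _ (Finset.mem_image_of_mem _ (by simpa using Nat.lt_succ_of_le hi))) (fun i _ => hy i)
  have hx0 : x ≠ 0 := by rintro rfl; simp at hx1
  set q := p ^ s with hq
  set X : ℕ → Ω := fun j => (D σ ^ j) x with hX
  set W : ℕ → Fin N → F := fun m => ((A - 1) ^ m).mulVec w with hWdef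
  have hXs : ∀ j, σ (X j) = X j + X (j + 1) := by
    intro j
    simp only [X, pow_succ', Module.End.mul_apply, D_apply]; ring
  have hXq : X q = 1 := by simp only [X, hq]; rw [Dpow_char hp, hx1]; ring
  have hXq1 : X (q + 1) = 0 := by
    have := hXs q
    rw [hXq, map_one] at this
    simpa using this
  have hW : ∀ m, A.mulVec (W m) = W m + W (m + 1) := by
    intro m
    simp only [W, pow_succ', ← Matrix.mulVec_mulVec, Matrix.sub_mulVec, Matrix.one_mulVec]
    abel
  have hWq1 : W (q + 1) = 0 := by
    have := hW q
    have hWq : W q = v := hv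
    rw [hWq, hAv] at this
    simpa using this
  set u : Fin N → Ω := fun i => ∑ j ∈ Finset.range (q + 1), X j * algebraMap F Ω (W (q - j) i) with hu
  have hσu := u_eq (σ := σ) A q W hW hWq1 X hXs hXq1
  have hXL : ∀ j, X j ∈ L := by
    intro j
    induction j with
    | zero => simpa [X] using hxL
    | succ j ih =>
      have : X (j + 1) = σ (X j) - X j := by rw [hXs]; ring
      rw [this]; exact sub_mem (hLσ _ ih) ih
  have huL : ∀ i, u i ∈ L := fun i => sum_mem fun j _ => mul_mem (hXL j) (L.algebraMap_mem _)
  refine hx2 (aeval u f) d (aeval_mem_L L huL f) ?_ ?_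
  · have h1 : σ (aeval u f) = aeval (fun i => σ (u i)) f := by
      rw [← comp_aeval_apply]
    have h2 : aeval u (matAct A f) = aeval (fun i => σ (u i)) f := by
      rw [matAct, ← AlgHom.comp_apply, comp_aeval]
      congr 2
      funext i
      rw [hσu i]
      simp [u, map_sum]
    rw [h1, ← h2, hinv]
  · set u' : Fin N → Ω := fun i => u i / x with hu'
    have h1 : u = fun i => x * u' i := by funext i; simp only [u']; field_simp
    rw [h1, aeval_mul_homog hf, map_mul, map_pow]
    have hclose : ∀ i, nrm (u' i - algebraMap F Ω (v i)) < 1 := by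
      intro i
      have h2 : u' i - algebraMap F Ω (v i) =
          (∑ j ∈ Finset.range q, X (j + 1) * algebraMap F Ω (W (q - (j + 1)) i)) / x := by
        simp only [u', u]
        rw [Finset.sum_range_succ', Nat.sub_zero]
        have hWq : W q = v := hv
        have hX0 : X 0 = x := by simp [X]
        rw [hWq, hX0]
        field_simp
        ring
      rw [h2, map_div₀, div_lt_one (nrm.pos hx0)]
      refine h.sum_lt _ _ (nrm.pos hx0) fun j _ => ?_
      rw [map_mul]
      exact (mul_le_of_le_one_right (apply_nonneg _ _) (h.cst_le _)).trans_lt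
        (h.Dpow_lt hx0 hXq1 (Nat.succ_pos j))
    have hu1 : ∀ i, nrm (u' i) ≤ 1 := by
      intro i
      have := h.add (u' i - algebraMap F Ω (v i)) (algebraMap F Ω (v i))
      rw [sub_add_cancel] at this
      exact this.trans (max_le (hclose i).le (h.cst_le _))
    have h3 := (h.aeval_close hu1 (fun i => h.cst_le (v i)) hclose f).1
    have h4 : aeval (fun i => algebraMap F Ω (v i)) f = algebraMap F Ω (eval v f) := by
      have := aeval_algebraMap_apply Ω v f
      rw [← coe_aeval_eq_eval]
      exact this
    rw [h4] at h3
    rw [h.eq_of_sub_lt (x := aeval u' f) (by rw [h.cst _ hfv]; exact h3), h.cst _ hfv, mul_one]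
end VD

lemma exists_fixed {F : Type*} [Field F] {p : ℕ} (hp : p.Prime) [CharP F p]
    {G : Type*} [Group G] [Fintype G] (hG : IsPGroup p G) {N : ℕ}
    (ρ : G →* Matrix.GeneralLinearGroup (Fin N) F) (U : Submodule F (Fin N → F)) (hU : U ≠ ⊥)
    (hst : ∀ g : G, ∀ u ∈ U, (ρ g : Matrix (Fin N) (Fin N) F).mulVec u ∈ U) :
    ∃ v ∈ U, v ≠ 0 ∧ IsFixedPt ρ v := by
  have := Fact.mk hp
  obtain ⟨w, hwU, hw⟩ := Submodule.exists_mem_ne_zero_of_ne_bot hU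
  let _ : Algebra (ZMod p) F := ZMod.algebra F p
  let T : Submodule (ZMod p) (Fin N → F) :=
    Submodule.span (ZMod p) (Set.range fun g : G => (ρ g : Matrix (Fin N) (Fin N) F).mulVec w)
  have hTU : ∀ t ∈ T, t ∈ U := by
    have : T ≤ U.restrictScalars (ZMod p) := by
      rw [Submodule.span_le]
      rintro _ ⟨g, rfl⟩
      exact hst g w hwU
    exact this
  have hTst : ∀ g : G, ∀ t ∈ T, (ρ g : Matrix (Fin N) (Fin N) F).mulVec t ∈ T := by
    intro g
    have : T ≤ T.comap ((Matrix.mulVecLin (ρ g : Matrix (Fin N) (Fin N) F)).restrictScalars (ZMod p)) := by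
      nth_rw 1 [show T = Submodule.span (ZMod p) _ from rfl]
      rw [Submodule.span_le]
      rintro _ ⟨h, rfl⟩
      apply Submodule.subset_span
      refine ⟨g * h, ?_⟩
      simp [Matrix.mulVec_mulVec]
    exact this
  have hfg : Module.Finite (ZMod p) T := Module.Finite.span_of_finite _ (Set.finite_range _)
  have hfin : Finite T := Module.finite_of_finite (ZMod p)
  let _ : MulAction G T :=
    { smul := fun g t => ⟨(ρ g : Matrix (Fin N) (Fin N) F).mulVec t, hTst g t t.2⟩
      one_smul := fun t => Subtype.ext (by
        change (ρ 1 : Matrix (Fin N) (Fin N) F).mulVec t = t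
        simp)
      mul_smul := fun g h t => Subtype.ext (by
        change (ρ (g * h) : Matrix (Fin N) (Fin N) F).mulVec t =
          (ρ g : Matrix (Fin N) (Fin N) F).mulVec ((ρ h : Matrix (Fin N) (Fin N) F).mulVec t)
        simp [Matrix.mulVec_mulVec]) }
  have hwT : w ∈ T := Submodule.subset_span ⟨1, by simp⟩
  have hcard : p ∣ Nat.card T := by
    have h1 : addOrderOf (⟨w, hwT⟩ : T) = p := by
      refine addOrderOf_eq_prime ?_ ?_
      · rw [← Nat.cast_smul_eq_nsmul (ZMod p)]; simp
      · intro h; exact hw (congrArg Subtype.val h)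
    have h2 := addOrderOf_dvd_natCard (⟨w, hwT⟩ : T)
    rwa [h1] at h2
  obtain ⟨b, hb, hb0⟩ := hG.exists_fixed_point_of_prime_dvd_card_of_fixed_point T hcard (a := 0)
    (fun g => Subtype.ext (by
      change (ρ g : Matrix (Fin N) (Fin N) F).mulVec ((0 : T) : Fin N → F) = _
      simp))
  refine ⟨b, hTU b b.2, fun h => hb0 (Subtype.ext h.symm), fun g => ?_⟩
  exact congrArg Subtype.val (hb g)

lemma matAct_matAct {F : Type*} [Field F] {N : ℕ} (A B : Matrix (Fin N) (Fin N) F)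
    (f : MvPolynomial (Fin N) F) : matAct A (matAct B f) = matAct (B * A) f := by
  have : (matAct A).comp (matAct B) = matAct (B * A) := by
    ext i
    simp only [AlgHom.comp_apply, matAct, aeval_X, map_sum, map_mul, algHom_C]
    simp only [Matrix.mul_apply, map_sum, map_mul, Finset.sum_mul, Finset.mul_sum]
    rw [Finset.sum_comm]
    simp [MvPolynomial.algebraMap_eq, mul_assoc]
  exact DFunLike.congr_fun this f

lemma eps_mem {F : Type*} [Field F] {G : Type*} [Group G] [Fintype G] {N : ℕ}
    (ρ : G →* Matrix.GeneralLinearGroup (Fin N) F) (v : Fin N → F) (hv : v ≠ 0)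
    (hfix : IsFixedPt ρ v) :
    Fintype.card G ∈ {d : ℕ | 0 < d ∧ ∃ f : MvPolynomial (Fin N) F,
      IsInv ρ f ∧ f.IsHomogeneous d ∧ eval v f ≠ 0} := by
  obtain ⟨i, hi⟩ := Function.ne_iff.mp hv
  refine ⟨Fintype.card_pos, ∏ g : G, matAct (ρ g : Matrix (Fin N) (Fin N) F) (X i), ?_, ?_, ?_⟩
  · intro τ
    rw [map_prod]
    simp only [matAct_matAct]
    refine Fintype.prod_equiv (Equiv.mulRight τ⁻¹) _ _ fun g => ?_
    simp
  · have h := IsHomogeneous.prod Finset.univ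
      (fun g : G => matAct (ρ g : Matrix (Fin N) (Fin N) F) (X i)) (fun _ => 1) (fun g _ => ?_)
    · simpa using h
    · simp only [matAct, aeval_X]
      refine IsHomogeneous.sum _ _ _ fun j _ => ?_
      simpa using (isHomogeneous_C _ _).mul (isHomogeneous_X F j)
  · rw [map_prod, Finset.prod_ne_zero_iff]
    intro g _
    have := congrFun (hfix g) i
    rw [Matrix.mulVec, dotProduct] at this
    simp only [matAct, aeval_X, map_sum, map_mul, eval_C, eval_X]
    rw [this]; exact hi


theorem stmt6 {F : Type*} [Field F] [IsAlgClosed F] {p : ℕ} (hp : p.Prime) [CharP F p]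
    {G : Type*} [Group G] [Fintype G] (hG : IsPGroup p G)
    {N : ℕ} (hN : 0 < N) (ρ : G →* Matrix.GeneralLinearGroup (Fin N) F)
    (hfaithful : Function.Injective ρ)
    (σ : G) (r : ℕ) (hord : orderOf σ = p ^ r)
    (hcentral : σ ^ p ^ (r - 1) ∈ Subgroup.center G) :
    p ^ r ≤ deltaGV ρ := by
  have hcore : ∃ v : Fin N → F, v ≠ 0 ∧ IsFixedPt ρ v ∧
      ∀ d > 0, ∀ f : MvPolynomial (Fin N) F, IsInv ρ f → f.IsHomogeneous d → eval v f ≠ 0 →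
        p ^ r ≤ d := by
    rcases r with _ | s
    · have hnt : Nontrivial (Fin N → F) := by
        have : Nonempty (Fin N) := ⟨⟨0, hN⟩⟩
        infer_instance
      obtain ⟨v, -, hv, hfix⟩ := exists_fixed hp hG ρ ⊤ top_ne_bot (by simp)
      exact ⟨v, hv, hfix, fun d hd _ _ _ _ => by rw [pow_zero]; exact hd⟩
    · have := Fact.mk hp
      have : Nonempty (Fin N) := ⟨⟨0, hN⟩⟩
      rw [Nat.add_sub_cancel] at hcentral
      set A : Matrix (Fin N) (Fin N) F := (ρ σ : Matrix (Fin N) (Fin N) F) with hA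
      have hE : (A - 1) ^ (p ^ s) = (ρ (σ ^ p ^ s) : Matrix (Fin N) (Fin N) F) - 1 := by
        have h1 := sub_pow_expChar_pow_of_commute p s (Commute.one_right A)
        rw [h1, one_pow, map_pow, Units.val_pow_eq_pow_val]
      refine (exists_fixed hp hG ρ
        (LinearMap.range (Matrix.mulVecLin ((A - 1) ^ (p ^ s)))) ?_ ?_).elim ?_
      rotate_left 2
      · rintro v ⟨hvU, hv, hfix⟩
        obtain ⟨w, hw⟩ := hvU
        refine ⟨v, hv, hfix, fun d hd f hinv hf hfv => ?_⟩
        refine Nat.le_of_dvd hd (VD.dvd_claim hp A s w v hw (hfix σ) f d hf ?_ hfv)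
        have := hinv σ⁻¹
        rwa [inv_inv] at this
      · intro h
        rw [LinearMap.range_eq_bot] at h
        have h0 : (A - 1) ^ (p ^ s) = 0 := by
          apply Matrix.toLin'.injective
          rw [map_zero]
          exact h
        rw [hE, sub_eq_zero] at h0
        have h1 : ρ (σ ^ p ^ s) = ρ 1 := by
          rw [map_one]; exact Units.ext h0
        have h2 := orderOf_dvd_of_pow_eq_one (hfaithful h1)
        rw [hord, Nat.pow_dvd_pow_iff_le_right hp.one_lt] at h2
        omega
      · rintro g _ ⟨w, rfl⟩
        refine ⟨(ρ g : Matrix (Fin N) (Fin N) F).mulVec w, ?_⟩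
        have hcomm : (ρ g : Matrix (Fin N) (Fin N) F) * (ρ (σ ^ p ^ s) : Matrix (Fin N) (Fin N) F) =
            (ρ (σ ^ p ^ s) : Matrix (Fin N) (Fin N) F) * (ρ g : Matrix (Fin N) (Fin N) F) := by
          rw [← Units.val_mul, ← Units.val_mul, ← map_mul, ← map_mul,
            Subgroup.mem_center_iff.mp hcentral g]
        simp only [Matrix.mulVecLin_apply, Matrix.mulVec_mulVec, hE, sub_mul, mul_sub, hcomm,
          one_mul, mul_one]
  obtain ⟨v, hv, hfix, hle⟩ := hcore
  have hmem := Nat.sInf_mem ⟨_, eps_mem ρ v hv hfix⟩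
  obtain ⟨hpos, f, hinv, hf, hfv⟩ := hmem
  have h1 : p ^ r ≤ epsGV ρ v := hle _ hpos f hinv hf hfv
  refine h1.trans (le_csSup ⟨Fintype.card G, ?_⟩ ⟨v, hv, hfix, rfl⟩)
  rintro _ ⟨v', hv', hfix', rfl⟩
  exact Nat.sInf_le (eps_mem ρ v' hv' hfix')
end

section
/- Let $F$ be an algebraically closed field of characteristic $p > 0$ and $\tilde G$ a non-trivial finite $p$-group. Then for every faithful finite-dimensional $\tilde G$-module $V$ over $F$, $\delta(\tilde G, V) \ge \exp(Z(\tilde G)) \ge p$, where $\exp$ denotes the group exponent and $Z(\tilde G)$ the center. In particular, if $\tilde G$ is abelian, $\delta(\tilde G, V) \ge \exp(\tilde G) \ge p$. -/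
open MvPolynomial

lemma aux_eval_matAct {F : Type*} [Field F] {N : ℕ} (A : Matrix (Fin N) (Fin N) F)
    (f : MvPolynomial (Fin N) F) (v : Fin N → F) :
    eval v (matAct A f) = eval (Matrix.mulVec A v) f := by
  unfold matAct
  rw [← MvPolynomial.coe_aeval_eq_eval, RingHom.coe_coe, ← AlgHom.comp_apply, comp_aeval,
    ← MvPolynomial.coe_aeval_eq_eval, RingHom.coe_coe]
  congr 2
  funext i
  simp [Matrix.mulVec, dotProduct]

lemma aux_matAct_mul {F : Type*} [Field F] [Infinite F] {N : ℕ} (A B : Matrix (Fin N) (Fin N) F)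
    (f : MvPolynomial (Fin N) F) :
    matAct A (matAct B f) = matAct (B * A) f := by
  apply MvPolynomial.funext
  intro v
  simp only [aux_eval_matAct, Matrix.mulVec_mulVec]

lemma aux_eval_inv {F : Type*} [Field F] {N : ℕ} {G : Type*} [Group G]
    (ρ : G →* Matrix.GeneralLinearGroup (Fin N) F) {f : MvPolynomial (Fin N) F}
    (hf : IsInv ρ f) (σ : G) (v : Fin N → F) :
    eval (Matrix.mulVec ((ρ σ : Matrix.GeneralLinearGroup (Fin N) F) :
      Matrix (Fin N) (Fin N) F) v) f = eval v f := by
  have := hf σ⁻¹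
  rw [inv_inv] at this
  rw [← aux_eval_matAct, this]

/-- The norm of a coordinate shows that `epsGV` is bounded by the group order. -/
lemma aux_norm {F : Type*} [Field F] [Infinite F] {N : ℕ} {G : Type*} [Group G] [Fintype G]
    (ρ : G →* Matrix.GeneralLinearGroup (Fin N) F) (v : Fin N → F) (hv : v ≠ 0)
    (hfix : IsFixedPt ρ v) :
    ∃ f : MvPolynomial (Fin N) F, IsInv ρ f ∧ f.IsHomogeneous (Fintype.card G) ∧ eval v f ≠ 0 := by
  obtain ⟨i, hi⟩ := Function.ne_iff.mp hv
  refine ⟨∏ σ : G, matAct ((ρ σ : Matrix.GeneralLinearGroup (Fin N) F) :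
    Matrix (Fin N) (Fin N) F) (X i), ?_, ?_, ?_⟩
  · intro τ
    rw [map_prod]
    refine Fintype.prod_equiv (Equiv.mulRight τ⁻¹) _ _ ?_
    intro σ
    rw [aux_matAct_mul]
    simp [map_mul]
  · have := MvPolynomial.IsHomogeneous.prod (Finset.univ : Finset G)
      (fun σ => matAct ((ρ σ : Matrix.GeneralLinearGroup (Fin N) F) :
        Matrix (Fin N) (Fin N) F) (X i)) (fun _ => 1) ?_
    · simpa using this
    · intro σ _
      simp only [matAct, aeval_X]
      apply MvPolynomial.IsHomogeneous.sum
      intro j _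
      exact isHomogeneous_C_mul_X _ _
  · rw [map_prod]
    apply Finset.prod_ne_zero_iff.mpr
    intro σ _
    rw [aux_eval_matAct, hfix σ, eval_X]
    exact hi

lemma aux_le_delta {F : Type*} [Field F] [Infinite F] {N : ℕ} {G : Type*} [Group G] [Fintype G]
    (ρ : G →* Matrix.GeneralLinearGroup (Fin N) F) (v : Fin N → F) (hv : v ≠ 0)
    (hfix : IsFixedPt ρ v) (q : ℕ)
    (h : ∀ (d : ℕ) (f : MvPolynomial (Fin N) F), IsInv ρ f → f.IsHomogeneous d → eval v f ≠ 0 →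
      q ∣ d) : q ≤ deltaGV ρ := by
  have h1 : q ≤ epsGV ρ v := by
    have hne : {d : ℕ | 0 < d ∧ ∃ f : MvPolynomial (Fin N) F,
        IsInv ρ f ∧ f.IsHomogeneous d ∧ eval v f ≠ 0}.Nonempty :=
      ⟨_, Fintype.card_pos, aux_norm ρ v hv hfix⟩
    obtain ⟨hd, f, hf1, hf2, hf3⟩ := Nat.sInf_mem hne
    exact Nat.le_of_dvd hd (h _ f hf1 hf2 hf3)
  refine h1.trans (le_csSup ⟨Fintype.card G, ?_⟩ ⟨v, hv, hfix, rfl⟩)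
  rintro e ⟨u, hu, hufix, rfl⟩
  exact Nat.sInf_le ⟨Fintype.card_pos, aux_norm ρ u hu hufix⟩

/-- Chain rule. -/
lemma aux_chain {F : Type*} [Field F] {N : ℕ} {S : Type*} [CommRing S] [Algebra F S]
    (D : Derivation F S S) (a : Fin N → S) (f : MvPolynomial (Fin N) F) :
    D (aeval a f) = ∑ i, aeval a (pderiv i f) * D (a i) := by
  induction f using MvPolynomial.induction_on with
  | C c => simp [algHom_C]
  | add f g hf hg => simp [hf, hg, add_mul, Finset.sum_add_distrib]
  | mul_X f n hf =>
    simp only [map_mul, aeval_X, Derivation.leibniz, hf, smul_eq_mul, map_add, pderiv_X]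
    simp only [add_mul, Finset.sum_add_distrib, Finset.mul_sum]
    congr 1
    · rw [Finset.sum_eq_single n]
      · simp
      · intro j _ hj
        simp [hj.symm]
      · simp
    · apply Finset.sum_congr rfl
      intros
      ring

/-- Directional derivative invariance at a fixed point. -/
lemma aux_dir {F : Type*} [Field F] [Infinite F] {N : ℕ} (f : MvPolynomial (Fin N) F)
    (A : Matrix (Fin N) (Fin N) F) (hf : ∀ v, eval (A.mulVec v) f = eval v f)
    (v w : Fin N → F) (hv : A.mulVec v = v) :
    ∑ i, eval v (pderiv i f) * (A.mulVec w i - w i) = 0 := by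
  let P : (Fin N → F) → Polynomial F := fun u =>
    aeval (fun i => Polynomial.C (v i) + Polynomial.C (u i) * Polynomial.X) f
  have hP : ∀ u t, Polynomial.eval t (P u) = eval (v + t • u) f := by
    intro u t
    change Polynomial.aeval t (aeval (fun i => Polynomial.C (v i) +
      Polynomial.C (u i) * Polynomial.X) f) = _
    rw [← AlgHom.comp_apply, comp_aeval,
      ← MvPolynomial.coe_aeval_eq_eval, RingHom.coe_coe]
    congr 2
    funext i
    simp
    ring
  have hPP : P (A.mulVec w) = P w := by
    apply Polynomial.funext
    intro t
    rw [hP, hP, ← hf (v + t • w), Matrix.mulVec_add, Matrix.mulVec_smul, hv]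
  have hD : ∀ u, Polynomial.eval 0 (Polynomial.derivative (P u)) =
      ∑ i, eval v (pderiv i f) * u i := by
    intro u
    have := aux_chain (Polynomial.derivative' (R := F))
      (fun i => Polynomial.C (v i) + Polynomial.C (u i) * Polynomial.X) f
    rw [Polynomial.derivative'_apply] at this
    rw [this, Polynomial.eval_finsetSum]
    apply Finset.sum_congr rfl
    intro i _
    rw [Polynomial.eval_mul]
    congr 1
    · change Polynomial.aeval (0:F) _ = _
      rw [← AlgHom.comp_apply, comp_aeval,
        ← MvPolynomial.coe_aeval_eq_eval, RingHom.coe_coe]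
      congr 2
      funext i
      simp
    · simp
  have := hD (A.mulVec w)
  rw [hPP, hD w] at this
  simp only [mul_sub, Finset.sum_sub_distrib]
  rw [this, sub_self]

/-- Combinatorial core. -/
lemma aux_comb {F : Type*} [Field F] {p : ℕ} (hp : p.Prime) [CharP F p] (k m : ℕ) (hm : m = p ^ k)
    [NeZero m] (P : MvPolynomial (ZMod m) F) (d : ℕ) (hP : P.IsHomogeneous d)
    (hinv : rename (fun j => j + 1) P = P) (h1 : eval (fun _ => (1 : F)) P ≠ 0)
    (h0 : eval (fun _ => (1 : F)) (pderiv 0 P) = 0) : p ^ (k + 1) ∣ d := by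
  classical
  let e : ZMod m ≃ ZMod m := Equiv.addRight 1
  let S : F → Finset (ZMod m →₀ ℕ) := fun c => P.support.filter (fun α => coeff α P = c)
  have hcoeff : ∀ α : ZMod m →₀ ℕ, coeff (α.mapDomain e) P = coeff α P := by
    intro α
    conv_lhs => rw [← hinv]
    exact coeff_rename_mapDomain _ e.injective _ _
  have hstep : ∀ c j, ∑ α ∈ S c, α (j + 1) = ∑ α ∈ S c, α j := by
    intro c j
    symm
    refine Finset.sum_equiv (Finsupp.domCongr e).toEquiv ?_ ?_
    · intro α
      have := hcoeff α
      rw [← Finsupp.equivMapDomain_eq_mapDomain] at this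
      simp [S, this]
    · intro α _
      simp [e, Equiv.addRight]
  have hconst : ∀ c j, ∑ α ∈ S c, α j = ∑ α ∈ S c, α 0 := by
    intro c j
    have : ∀ n : ℕ, ∑ α ∈ S c, α (n : ZMod m) = ∑ α ∈ S c, α 0 := by
      intro n
      induction n with
      | zero => simp
      | succ n ih => rw [Nat.cast_succ, hstep, ih]
    simpa using this j.val
  have hdeg : ∀ c, m * ∑ α ∈ S c, α 0 = d * (S c).card := by
    intro c
    have h2 : ∑ j : ZMod m, ∑ α ∈ S c, α j = m * ∑ α ∈ S c, α 0 := by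
      simp [hconst c, ZMod.card]
    rw [← h2, Finset.sum_comm, mul_comm, Finset.card_eq_sum_ones, Finset.sum_mul]
    apply Finset.sum_congr rfl
    intro α hα
    have h3 : coeff α P ≠ 0 := by
      simpa using (Finset.mem_filter.mp hα).1
    have h4 := hP h3
    rw [Finsupp.weight_apply, Finsupp.sum_fintype _ _ (by simp)] at h4
    simpa using h4
  have hev1 : eval (fun _ => (1 : F)) P =
      ∑ c ∈ P.support.image (fun α => coeff α P), c * ((S c).card : F) := by
    rw [eval_eq]
    simp only [one_pow, Finset.prod_const_one, mul_one]
    rw [← Finset.sum_fiberwise_of_maps_to (g := fun α => coeff α P)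
      (t := P.support.image (fun α => coeff α P)) (fun x hx => Finset.mem_image_of_mem _ hx)]
    apply Finset.sum_congr rfl
    intro c _
    rw [Finset.sum_congr rfl (g := fun _ => c) (fun x hx => (Finset.mem_filter.mp hx).2)]
    simp [S, mul_comm]
  have hev0 : eval (fun _ => (1 : F)) (pderiv 0 P) =
      ∑ c ∈ P.support.image (fun α => coeff α P), c * ((∑ α ∈ S c, α 0 : ℕ) : F) := by
    have : eval (fun _ => (1 : F)) (pderiv 0 P) = ∑ α ∈ P.support, coeff α P * (α 0 : F) := by
      have h5 := congrArg (fun R => eval (fun _ => (1 : F)) (pderiv 0 R)) P.as_sum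
      refine h5.trans ?_
      simp only [map_sum, pderiv_monomial, eval_monomial]
      simp
    rw [this]
    rw [← Finset.sum_fiberwise_of_maps_to (g := fun α => coeff α P)
      (t := P.support.image (fun α => coeff α P)) (fun x hx => Finset.mem_image_of_mem _ hx)]
    apply Finset.sum_congr rfl
    intro c _
    rw [Nat.cast_sum, Finset.mul_sum]
    apply Finset.sum_congr rfl
    intro x hx
    rw [(Finset.mem_filter.mp hx).2]
  have hmd : m ∣ d := by
    rw [hev1] at h1
    obtain ⟨c, _, hc⟩ := Finset.exists_ne_zero_of_sum_ne_zero h1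
    have hc2 : ¬ p ∣ (S c).card := by
      intro h
      apply hc
      rw [(CharP.cast_eq_zero_iff F p _).mpr h, mul_zero]
    have hcop : Nat.Coprime m (S c).card := by
      have h6 : ∀ n : ℕ, ¬ p ∣ n → Nat.Coprime m n := by
        intro n hn
        rw [hm]
        exact Nat.Coprime.pow_left _ ((Nat.Prime.coprime_iff_not_dvd hp).mpr hn)
      exact h6 _ hc2
    exact hcop.dvd_of_dvd_mul_right ⟨_, (hdeg c).symm⟩
  obtain ⟨e', rfl⟩ := hmd
  have hS : ∀ c, ∑ α ∈ S c, α 0 = e' * (S c).card := by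
    intro c
    have := hdeg c
    rw [mul_assoc] at this
    exact Nat.eq_of_mul_eq_mul_left (Nat.pos_of_ne_zero (NeZero.ne m)) this
  have hfin : (e' : F) * eval (fun _ => (1 : F)) P = 0 := by
    rw [← h0, hev0, hev1, Finset.mul_sum]
    apply Finset.sum_congr rfl
    intro c _
    rw [hS]
    push_cast
    ring
  have he : (e' : F) = 0 := (mul_eq_zero.mp hfin).resolve_right h1
  rw [CharP.cast_eq_zero_iff F p] at he
  rw [pow_succ, hm]
  exact Nat.mul_dvd_mul_left _ he

/-- A nonzero stable subspace contains a nonzero fixed vector. -/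
lemma aux_fixed {F : Type*} [Field F] {p : ℕ} (hp : p.Prime) [CharP F p]
    {G : Type*} [Group G] [Fintype G] (hG : IsPGroup p G) {N : ℕ}
    (ρ : G →* Matrix.GeneralLinearGroup (Fin N) F) (U : Submodule F (Fin N → F))
    (hU : ∀ (σ : G), ∀ u ∈ U, Matrix.mulVec ((ρ σ : Matrix.GeneralLinearGroup (Fin N) F) :
      Matrix (Fin N) (Fin N) F) u ∈ U) (u : Fin N → F) (hu : u ∈ U) (hu0 : u ≠ 0) :
    ∃ v ∈ U, v ≠ 0 ∧ IsFixedPt ρ v := by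
  classical
  have : Fact p.Prime := ⟨hp⟩
  let : Algebra (ZMod p) F := ZMod.algebra F p
  let act : G → (Fin N → F) → (Fin N → F) := fun σ x =>
    Matrix.mulVec ((ρ σ : Matrix.GeneralLinearGroup (Fin N) F) : Matrix (Fin N) (Fin N) F) x
  have act_add : ∀ σ x y, act σ (x + y) = act σ x + act σ y := fun σ x y => Matrix.mulVec_add _ _ _
  have act_smul : ∀ σ (c : F) x, act σ (c • x) = c • act σ x :=
    fun σ c x => Matrix.mulVec_smul _ _ _
  have act_mul : ∀ σ τ x, act (σ * τ) x = act σ (act τ x) := by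
    intro σ τ x
    simp [act, Matrix.mulVec_mulVec]
  have act_one : ∀ x, act 1 x = x := by
    intro x
    simp [act]
  let A : Submodule (ZMod p) (Fin N → F) := Submodule.span (ZMod p) (Set.range fun σ => act σ u)
  have hAact : ∀ σ, ∀ x ∈ A, act σ x ∈ A := by
    intro σ x hx
    induction hx using Submodule.span_induction with
    | mem x h =>
      obtain ⟨τ, rfl⟩ := h
      refine Submodule.subset_span ⟨σ * τ, act_mul _ _ _⟩
    | zero => simp [act]
    | add x y _ _ hx hy => rw [act_add]; exact A.add_mem hx hy
    | smul c x _ hx =>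
      have : act σ (c • x) = c • act σ x := by
        rw [← algebraMap_smul F c x, act_smul, algebraMap_smul]
      rw [this]; exact A.smul_mem _ hx
  have hAU : ∀ x ∈ A, x ∈ U := by
    intro x hx
    induction hx using Submodule.span_induction with
    | mem x h =>
      obtain ⟨τ, rfl⟩ := h
      exact hU _ _ hu
    | zero => exact U.zero_mem
    | add x y _ _ hx hy => exact U.add_mem hx hy
    | smul c x _ hx =>
      rw [← algebraMap_smul F c x]; exact U.smul_mem _ hx
  have : Module.Finite (ZMod p) A := Module.Finite.span_of_finite _ (Set.finite_range _)
  have : Finite A := Module.finite_of_finite (ZMod p)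
  let M : MulAction G A :=
    { smul := fun σ x => ⟨act σ x.1, hAact σ _ x.2⟩
      one_smul := fun x => Subtype.ext (act_one _)
      mul_smul := fun σ τ x => Subtype.ext (act_mul _ _ _) }
  have huA : u ∈ A := Submodule.subset_span ⟨1, act_one u⟩
  have hcard : p ∣ Nat.card A := by
    have h1 : addOrderOf (⟨u, huA⟩ : A) = p := by
      apply addOrderOf_eq_prime
      · apply Subtype.ext
        funext i
        simp
      · intro h
        exact hu0 (congrArg Subtype.val h)
    exact h1.symm.dvd.trans (addOrderOf_dvd_natCard _)
  have hz : (0 : A) ∈ MulAction.fixedPoints G A := by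
    intro σ
    apply Subtype.ext
    change act σ 0 = 0
    exact Matrix.mulVec_zero _
  obtain ⟨b, hb, hb0⟩ := hG.exists_fixed_point_of_prime_dvd_card_of_fixed_point A hcard hz
  refine ⟨b.1, hAU _ b.2, ?_, ?_⟩
  · intro h
    exact hb0 (Subtype.ext h.symm)
  · intro σ
    exact congrArg Subtype.val (hb σ)

lemma aux_sum_zmod {M : Type*} [AddCommMonoid M] (m : ℕ) [NeZero m] (b : ℕ → M) :
    ∑ j : ZMod m, b j.val = ∑ n ∈ Finset.range m, b n := by
  refine Finset.sum_bij' (fun j _ => j.val) (fun n _ => (n : ZMod m)) ?_ ?_ ?_ ?_ ?_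
  · intro j _
    exact Finset.mem_range.mpr (ZMod.val_lt j)
  · intro n _
    exact Finset.mem_univ _
  · intro j _
    simp
  · intro n hn
    exact ZMod.val_natCast_of_lt (Finset.mem_range.mp hn)
  · intro j _
    rfl

/-- Degrees of invariants not vanishing at `(A ^ m - 1) w`. -/
lemma aux_deg {F : Type*} [Field F] [Infinite F] {p : ℕ} (hp : p.Prime) [CharP F p] {N : ℕ}
    (A : Matrix (Fin N) (Fin N) F) (f : MvPolynomial (Fin N) F)
    (hf : ∀ v, eval (A.mulVec v) f = eval v f) (k m : ℕ) (hm : m = p ^ k) (v w : Fin N → F)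
    (hvw : v = (A ^ m).mulVec w - w) (hv : A.mulVec v = v) (d : ℕ) (hd : f.IsHomogeneous d)
    (hne : eval v f ≠ 0) : p ^ (k + 1) ∣ d := by
  have hm0 : NeZero m := ⟨by rw [hm]; exact pow_ne_zero _ hp.ne_zero⟩
  let b : ℕ → Fin N → F := fun n => (A ^ (n + 1)).mulVec w - (A ^ n).mulVec w
  have hb : ∀ n, A.mulVec (b n) = b (n + 1) := by
    intro n
    simp only [b, Matrix.mulVec_sub, Matrix.mulVec_mulVec, ← pow_succ']
  have hpv : ∀ n, (A ^ n).mulVec v = v := by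
    intro n
    induction n with
    | zero => simp
    | succ n ih => rw [pow_succ, ← Matrix.mulVec_mulVec, hv, ih]
  have hper : ∀ n, b (n + m) = b n := by
    intro n
    have h1 : ∀ n, (A ^ (n + m)).mulVec w = v + (A ^ n).mulVec w := by
      intro n
      have h2 := hpv n
      rw [hvw, Matrix.mulVec_sub, Matrix.mulVec_mulVec, ← pow_add, ← hvw] at h2
      rw [← h2, sub_add_cancel]
    simp only [b]
    rw [h1, show n + m + 1 = (n + 1) + m by ring, h1]
    abel
  have hmod : ∀ n, b (n % m) = b n := by
    intro n
    have h1 : ∀ t n, b (n + m * t) = b n := by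
      intro t
      induction t with
      | zero => simp
      | succ t ih =>
        intro n
        rw [mul_add, mul_one, ← add_assoc, hper, ih]
    conv_rhs => rw [← Nat.mod_add_div n m]
    rw [h1]
  have hbz : ∀ j : ZMod m, A.mulVec (b j.val) = b (j + 1).val := by
    intro j
    rw [hb, ← hmod (j.val + 1)]
    congr 1
    rw [ZMod.val_add, ZMod.val_one_eq_one_mod]
    simp
  have hsum : ∑ j : ZMod m, b j.val = v := by
    rw [aux_sum_zmod, Finset.sum_range_sub (fun n => (A ^ n).mulVec w), hvw]
    simp
  let a : Fin N → MvPolynomial (ZMod m) F := fun i => ∑ j : ZMod m, C (b j.val i) * X j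
  have hev : ∀ (h : MvPolynomial (Fin N) F) (y : ZMod m → F),
      eval y (aeval a h) = eval (∑ j : ZMod m, y j • b j.val) h := by
    intro h y
    rw [← MvPolynomial.coe_aeval_eq_eval, RingHom.coe_coe, ← AlgHom.comp_apply, comp_aeval,
      ← MvPolynomial.coe_aeval_eq_eval, RingHom.coe_coe]
    congr 2
    funext i
    simp [a, mul_comm]
  have hev1 : ∀ (h : MvPolynomial (Fin N) F), eval (fun _ => (1 : F)) (aeval a h) = eval v h := by
    intro h
    rw [hev]
    simp only [one_smul, hsum]
  refine aux_comb hp k m hm (aeval a f) d ?_ ?_ ?_ ?_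
  · have := hd.aeval a (n := 1) ?_
    · simpa using this
    · intro i
      apply MvPolynomial.IsHomogeneous.sum
      intro j _
      exact isHomogeneous_C_mul_X _ _
  · apply MvPolynomial.funext
    intro y
    rw [eval_rename, hev, hev, ← hf]
    congr 2
    rw [Matrix.mulVec_sum]
    simp only [Matrix.mulVec_smul, hbz, Function.comp]
    exact Fintype.sum_equiv (Equiv.addRight (1 : ZMod m)) _ _ (fun j => rfl)
  · rw [hev1]
    exact hne
  · rw [aux_chain, map_sum]
    have h1 := aux_dir f A hf v w hv
    rw [← h1]
    apply Finset.sum_congr rfl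
    intro i _
    rw [map_mul, hev1]
    congr 1
    simp only [a, map_sum, Derivation.leibniz, pderiv_C, pderiv_X]
    rw [Finset.sum_eq_single 0]
    · simp [b]
    · intro j _ hj
      simp [hj]
    · simp

lemma aux_main {F : Type*} [Field F] [IsAlgClosed F] {p : ℕ} (hp : p.Prime) [CharP F p]
    {G : Type*} [Group G] [Fintype G] (hG : IsPGroup p G)
    {N : ℕ} (ρ : G →* Matrix.GeneralLinearGroup (Fin N) F)
    (hfaithful : Function.Injective ρ) (g : G) (hg : ∀ x, x * g = g * x) (hg1 : g ≠ 1) :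
    orderOf g ≤ deltaGV ρ := by
  have : Fact p.Prime := ⟨hp⟩
  have : Infinite F := IsAlgClosed.instInfinite
  obtain ⟨k', hk'⟩ := IsPGroup.iff_orderOf.mp hG g
  obtain ⟨k, rfl⟩ : ∃ k, k' = k + 1 := by
    refine Nat.exists_eq_succ_of_ne_zero ?_
    rintro rfl
    exact hg1 (orderOf_eq_one_iff.mp (by simpa using hk'))
  have hgm : g ^ p ^ k ≠ 1 := by
    intro h
    have h1 := orderOf_dvd_of_pow_eq_one h
    rw [hk'] at h1
    have h2 := Nat.le_of_dvd (pow_pos hp.pos _) h1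
    exact absurd h2 (not_le.mpr (Nat.pow_lt_pow_right hp.one_lt (Nat.lt_succ_self k)))
  let A : Matrix (Fin N) (Fin N) F := (ρ g : Matrix.GeneralLinearGroup (Fin N) F)
  have hApow : ∀ n, ((ρ (g ^ n) : Matrix.GeneralLinearGroup (Fin N) F) :
      Matrix (Fin N) (Fin N) F) = A ^ n := by
    intro n
    simp [A]
  have hA : A ^ p ^ k ≠ 1 := by
    intro h
    apply hgm
    apply hfaithful
    apply Units.ext
    rw [hApow, h, map_one]
    rfl
  obtain ⟨w₀, hw₀⟩ : ∃ w₀, (A ^ p ^ k - 1).mulVec w₀ ≠ 0 := by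
    by_contra! h
    apply hA
    rw [← sub_eq_zero]
    apply Matrix.mulVec_injective
    funext x
    simp [h x]
  obtain ⟨v, ⟨w, hw⟩, hv0, hvfix⟩ := aux_fixed hp hG ρ
    (LinearMap.range (A ^ p ^ k - 1).mulVecLin) (by
      rintro σ _ ⟨x, rfl⟩
      refine ⟨Matrix.mulVec ((ρ σ : Matrix.GeneralLinearGroup (Fin N) F) :
        Matrix (Fin N) (Fin N) F) x, ?_⟩
      have hc : Commute ((ρ σ : Matrix.GeneralLinearGroup (Fin N) F) :
        Matrix (Fin N) (Fin N) F) A := by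
        have h1 := congrArg (fun x => ((ρ x : Matrix.GeneralLinearGroup (Fin N) F) :
          Matrix (Fin N) (Fin N) F)) (hg σ)
        simp only [map_mul, Units.val_mul] at h1
        exact h1
      have hc2 := (hc.pow_right (p ^ k)).sub_right (Commute.one_right _)
      simp only [Matrix.mulVecLin_apply, Matrix.mulVec_mulVec]
      rw [hc2.eq]) _ ⟨w₀, rfl⟩ hw₀
  rw [hk']
  refine aux_le_delta ρ v hv0 hvfix _ ?_
  intro d f hf hd hne
  refine aux_deg hp A f (fun u => aux_eval_inv ρ hf g u) k (p ^ k) rfl v w ?_ (hvfix g) d hd hne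
  rw [← hw]
  simp

lemma aux_exp {H : Type*} [Group H] [Finite H] (hc : ∀ a b : H, a * b = b * a) :
    ∃ z : H, orderOf z = Monoid.exponent H := by
  let I : CommGroup H := { ‹Group H› with mul_comm := hc }
  exact Monoid.exists_orderOf_eq_exponent (G := H) Monoid.ExponentExists.of_finite

theorem stmt7 {F : Type*} [Field F] [IsAlgClosed F] {p : ℕ} (hp : p.Prime) [CharP F p]
    {G : Type*} [Group G] [Fintype G] [Nontrivial G] (hG : IsPGroup p G)
    {N : ℕ} (hN : 0 < N) (ρ : G →* Matrix.GeneralLinearGroup (Fin N) F)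
    (hfaithful : Function.Injective ρ) :
    p ≤ Monoid.exponent (Subgroup.center G) ∧
    Monoid.exponent (Subgroup.center G) ≤ deltaGV ρ ∧
    ((∀ a b : G, a * b = b * a) → Monoid.exponent G ≤ deltaGV ρ) := by
  have : Fact p.Prime := ⟨hp⟩
  have hnt : Nontrivial (Subgroup.center G) := hG.center_nontrivial
  have hZ : IsPGroup p (Subgroup.center G) := hG.to_subgroup _
  obtain ⟨z, hz⟩ : ∃ z : Subgroup.center G,
      orderOf z = Monoid.exponent (Subgroup.center G) :=
    aux_exp (fun a b => Subtype.ext (Subgroup.mem_center_iff.mp b.2 a.1))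
  have hp1 : p ≤ Monoid.exponent (Subgroup.center G) := by
    obtain ⟨x, hx⟩ := exists_ne (1 : Subgroup.center G)
    obtain ⟨k, hk⟩ := IsPGroup.iff_orderOf.mp hZ x
    have hk0 : k ≠ 0 := by
      rintro rfl
      exact hx (orderOf_eq_one_iff.mp (by simpa using hk))
    have h1 : p ∣ Monoid.exponent (Subgroup.center G) :=
      ((dvd_pow_self p hk0).trans hk.symm.dvd).trans (Monoid.order_dvd_exponent x)
    exact Nat.le_of_dvd (Nat.pos_of_ne_zero Monoid.exponent_ne_zero_of_finite) h1
  have h2 : Monoid.exponent (Subgroup.center G) ≤ deltaGV ρ := by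
    rw [← hz, ← Subgroup.orderOf_coe]
    refine aux_main hp hG ρ hfaithful z.1 (Subgroup.mem_center_iff.mp z.2) ?_
    intro h
    have h3 : orderOf z = 1 := by
      rw [← Subgroup.orderOf_coe, h, orderOf_one]
    have := hp.one_lt
    omega
  refine ⟨hp1, h2, fun hcomm => le_trans ?_ h2⟩
  refine Nat.le_of_dvd (Nat.pos_of_ne_zero Monoid.exponent_ne_zero_of_finite) ?_
  refine Monoid.exponent_dvd_of_forall_pow_eq_one fun x => ?_
  have h4 := Monoid.pow_exponent_eq_one
    (⟨x, Subgroup.mem_center_iff.mpr fun y => hcomm y x⟩ : Subgroup.center G)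
  exact congrArg Subtype.val h4
end
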